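/- arXiv:0803.1740 — 5 statements merged into one kernel-verified Lean document; each statement's English description precedes it below -/
import Mathlib

section
/- There exist absolute constants C, c > 0 with the following property. Let b₂ > b₁ > 0, ε ∈ (0, 1/12) and β be real. Then there exists x₀ (depending on b₁, b₂, β, ε) such that for every real x ≥ x₀ there is a Lebesgue-measurable exceptional set J_E ⊆ (b₁,b₂) with mes(J_E) ≤ c·x^{−ε}, such that for every irrational α ∈ (b₁,b₂)∖J_E one has π*_{α,β}(x) ≤ C·x/(log x)². -/
open MeasureTheory

/-- `piStar α β x` counts the primes `p ≤ x` such that `⌊α p + β⌋` is also prime. -/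
noncomputable def piStar (α β x : ℝ) : ℕ :=
  {p : ℕ | p.Prime ∧ (p : ℝ) ≤ x ∧ Nat.Prime (⌊α * p + β⌋).toNat}.ncard

open ArithmeticFunction in
theorem sum_moebius_div_between {D f g : ℕ} (hf : 1 ≤ f) (hg : g ∈ Finset.Icc 1 D) :
    (∑ d ∈ Finset.Icc 1 D, if f ∣ d ∧ d ∣ g then (moebius (g / d) : ℝ) else 0) =
      if g = f then 1 else 0 := by
  rw [Finset.mem_Icc] at hg
  by_cases hfg : f ∣ g
  · obtain ⟨h, rfl⟩ := hfg
    have hh : 0 < h := Nat.pos_of_ne_zero (by rintro rfl; simp at hg)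
    rw [← Finset.sum_filter]
    have key : ∑ k ∈ h.divisors, (moebius (h / k) : ℝ) = if h = 1 then 1 else 0 := by
      rw [Nat.sum_div_divisors h (fun k => (moebius k : ℝ))]
      have := congrArg (fun F : ArithmeticFunction ℤ => F h) moebius_mul_coe_zeta
      simp only [coe_mul_zeta_apply, one_apply] at this
      exact_mod_cast this
    have hcond : (f * h = f) ↔ h = 1 := by
      constructor
      · intro e
        nlinarith
      · rintro rfl
        simp
    simp only [hcond]
    rw [← key]
    symm
    refine Finset.sum_bij (fun k _ => f * k) ?_ ?_ ?_ ?_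
    · intro k hk
      obtain ⟨hk1, -⟩ := Nat.mem_divisors.mp hk
      have := Nat.le_of_dvd hh hk1
      have h0 := Nat.pos_of_dvd_of_pos hk1 hh
      simp only [Finset.mem_filter, Finset.mem_Icc]
      refine ⟨⟨Nat.mul_pos hf h0, (Nat.mul_le_mul_left f this).trans hg.2⟩, dvd_mul_right _ _,
        mul_dvd_mul_left _ hk1⟩
    · intro a _ b _ hab
      exact Nat.eq_of_mul_eq_mul_left hf hab
    · intro d hd
      simp only [Finset.mem_filter, Finset.mem_Icc] at hd
      obtain ⟨-, ⟨k, rfl⟩, h2⟩ := hd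
      exact ⟨k, Nat.mem_divisors.mpr ⟨Nat.dvd_of_mul_dvd_mul_left hf h2, hh.ne'⟩, rfl⟩
    · intro k hk
      rw [Nat.mul_div_mul_left _ _ hf]
  · rw [if_neg (by rintro rfl; exact hfg dvd_rfl)]
    refine Finset.sum_eq_zero fun d _ => if_neg fun h => hfg (h.1.trans h.2)

theorem sum_Icc_inv_sq_le_two (D : ℕ) : ∑ m ∈ Finset.Icc 1 D, (1 : ℝ) / (m : ℝ) ^ 2 ≤ 2 := by
  rcases Nat.eq_zero_or_pos D with rfl | hD
  · simp
  have h := sum_Ioc_inv_sq_le_sub (α := ℝ) (k := 1) (n := D) one_ne_zero hD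
  rw [← Finset.add_sum_Ioc_eq_sum_Icc hD]
  have : (0 : ℝ) ≤ (D : ℝ)⁻¹ := by positivity
  simp only [one_div]
  norm_num at h ⊢
  linarith

open ArithmeticFunction in
theorem log_le_two_mul_sum_moebius_sq_div_totient (D : ℕ) :
    Real.log (D + 1) ≤
      2 * ∑ f ∈ Finset.Icc 1 D, (moebius f : ℝ) ^ 2 / (Nat.totient f : ℝ) := by
  have h1 : Real.log (D + 1) ≤ ∑ n ∈ Finset.Icc 1 D, (1 : ℝ) / n := by
    have := log_add_one_le_harmonic D
    rw [harmonic_eq_sum_Icc] at this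
    push_cast at this
    simpa [one_div] using this
  refine h1.trans ?_
  have h2 : ∀ n ∈ Finset.Icc 1 D, (1 : ℝ) / n ≤ ∑ m ∈ Finset.Icc 1 D, ∑ f ∈ Finset.Icc 1 D,
      if m ^ 2 * f = n then (1 / (m : ℝ) ^ 2) * ((moebius f : ℝ) ^ 2 / Nat.totient f) else 0 := by
    intro n hn
    rw [Finset.mem_Icc] at hn
    obtain ⟨a, b, ha, hb, hab, hsq⟩ := Nat.sq_mul_squarefree_of_pos hn.1
    have hbD : b ≤ D := by nlinarith
    have haD : a ≤ D := by
      have := Nat.le_mul_of_pos_left a (pow_pos hb 2)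
      lia
    have hterm : (1 : ℝ) / n ≤
        if b ^ 2 * a = n then (1 / (b : ℝ) ^ 2) * ((moebius a : ℝ) ^ 2 / Nat.totient a) else 0 := by
      rw [if_pos hab, ← hab]
      have : ((moebius a : ℝ) ^ 2) = 1 := by
        exact_mod_cast moebius_sq_eq_one_of_squarefree hsq
      rw [this]
      push_cast
      rw [one_div_mul_one_div]
      have h3 : (0 : ℝ) < Nat.totient a := by exact_mod_cast Nat.totient_pos.mpr ha
      have h4 : (Nat.totient a : ℝ) ≤ a := by exact_mod_cast Nat.totient_le a
      gcongr
    refine hterm.trans ?_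
    refine le_trans ?_ (Finset.single_le_sum (f := fun m => ∑ f ∈ Finset.Icc 1 D,
      if m ^ 2 * f = n then (1 / (m : ℝ) ^ 2) * ((moebius f : ℝ) ^ 2 / Nat.totient f) else 0)
      (fun i _ => Finset.sum_nonneg fun j _ => by positivity)
      (Finset.mem_Icc.mpr ⟨hb, hbD⟩))
    exact Finset.single_le_sum (f := fun f =>
      if b ^ 2 * f = n then (1 / (b : ℝ) ^ 2) * ((moebius f : ℝ) ^ 2 / Nat.totient f) else 0)
      (fun i _ => by positivity) (Finset.mem_Icc.mpr ⟨ha, haD⟩)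
  refine (Finset.sum_le_sum h2).trans ?_
  rw [Finset.sum_comm]
  calc _ ≤ ∑ m ∈ Finset.Icc 1 D, ∑ f ∈ Finset.Icc 1 D,
        (1 / (m : ℝ) ^ 2) * ((moebius f : ℝ) ^ 2 / Nat.totient f) := by
        refine Finset.sum_le_sum fun m _ => ?_
        rw [Finset.sum_comm]
        refine Finset.sum_le_sum fun f _ => ?_
        rw [Finset.sum_ite_eq]
        split_ifs
        · exact le_rfl
        · positivity
    _ = (∑ m ∈ Finset.Icc 1 D, (1 : ℝ) / (m : ℝ) ^ 2) *
          ∑ f ∈ Finset.Icc 1 D, (moebius f : ℝ) ^ 2 / Nat.totient f := by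
        rw [Finset.sum_mul_sum]
    _ ≤ _ := by
        gcongr
        exact sum_Icc_inv_sq_le_two D

theorem one_div_lcm_eq_sum_totient {D d e : ℕ} (hd : d ∈ Finset.Icc 1 D)
    (he : e ∈ Finset.Icc 1 D) :
    (1 : ℝ) / Nat.lcm d e = ∑ f ∈ Finset.Icc 1 D,
      (Nat.totient f : ℝ) * ((if f ∣ d then (1 : ℝ) / d else 0) *
        (if f ∣ e then (1 : ℝ) / e else 0)) := by
  rw [Finset.mem_Icc] at hd he
  have h1 : (Nat.gcd d e : ℝ) = ∑ f ∈ Finset.Icc 1 D,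
      if f ∣ d ∧ f ∣ e then (Nat.totient f : ℝ) else 0 := by
    rw [← Finset.sum_filter]
    conv_lhs => rw [← Nat.sum_totient (Nat.gcd d e)]
    push_cast
    refine Finset.sum_congr ?_ fun _ _ => rfl
    ext f
    have hg : 0 < Nat.gcd d e := Nat.gcd_pos_of_pos_left _ hd.1
    simp only [Nat.mem_divisors, Finset.mem_filter, Finset.mem_Icc, Nat.dvd_gcd_iff]
    constructor
    · rintro ⟨⟨h1, h2⟩, -⟩
      exact ⟨⟨Nat.pos_of_dvd_of_pos h1 hd.1, (Nat.le_of_dvd hd.1 h1).trans hd.2⟩, h1, h2⟩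
    · rintro ⟨-, h⟩
      exact ⟨h, hg.ne'⟩
  have h2 : (Nat.gcd d e : ℝ) * Nat.lcm d e = d * e := by exact_mod_cast Nat.gcd_mul_lcm d e
  have hd0 : (d : ℝ) ≠ 0 := by have := hd.1; positivity
  have he0 : (e : ℝ) ≠ 0 := by have := he.1; positivity
  have hl0 : (Nat.lcm d e : ℝ) ≠ 0 := by
    have := Nat.lcm_pos hd.1 he.1
    positivity
  have h3 : (1 : ℝ) / Nat.lcm d e = (Nat.gcd d e : ℝ) * (1 / d * (1 / e)) := by
    field_simp
    linarith
  rw [h3, h1, Finset.sum_mul]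
  refine Finset.sum_congr rfl fun f _ => ?_
  by_cases a : f ∣ d <;> by_cases b : f ∣ e <;> simp [a, b]

open ArithmeticFunction in
/-- The weights of the one-dimensional Selberg sieve of level `D ^ 2`. -/
theorem exists_selberg_weights {D : ℕ} (hD : 1 ≤ D) :
    ∃ w : ℕ → ℝ, w 1 = 1 ∧ (∀ d ∈ Finset.Icc 1 D, |w d| ≤ D) ∧
      0 ≤ ∑ d ∈ Finset.Icc 1 D, ∑ e ∈ Finset.Icc 1 D, w d * w e / Nat.lcm d e ∧
      ∑ d ∈ Finset.Icc 1 D, ∑ e ∈ Finset.Icc 1 D, w d * w e / Nat.lcm d e ≤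
        2 / Real.log (D + 1) := by
  have hlog : 0 < Real.log ((D : ℝ) + 1) := Real.log_pos (by exact_mod_cast Nat.lt_succ_of_le hD)
  have hS := log_le_two_mul_sum_moebius_sq_div_totient D
  set S := ∑ f ∈ Finset.Icc 1 D, (moebius f : ℝ) ^ 2 / (Nat.totient f : ℝ) with hSdef
  have hSpos : 0 < S := by linarith
  set y : ℕ → ℝ := fun f => (moebius f : ℝ) / (Nat.totient f * S) with hy
  set w : ℕ → ℝ := fun d => d * ∑ g ∈ Finset.Icc 1 D,
    if d ∣ g then (moebius (g / d) : ℝ) * y g else 0 with hw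
  have hinv : ∀ f ∈ Finset.Icc 1 D,
      ∑ d ∈ Finset.Icc 1 D, w d * (if f ∣ d then (1 : ℝ) / d else 0) = y f := by
    intro f hf
    calc _ = ∑ d ∈ Finset.Icc 1 D, ∑ g ∈ Finset.Icc 1 D,
          y g * (if f ∣ d ∧ d ∣ g then (moebius (g / d) : ℝ) else 0) := by
          refine Finset.sum_congr rfl fun d hd => ?_
          have hd0 : (d : ℝ) ≠ 0 := by
            have := (Finset.mem_Icc.mp hd).1
            positivity
          by_cases h : f ∣ d
          · simp only [hw, h, if_true, true_and]
            rw [mul_right_comm, mul_one_div_cancel hd0, one_mul]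
            refine Finset.sum_congr rfl fun g _ => ?_
            split_ifs <;> ring
          · simp [h]
      _ = ∑ g ∈ Finset.Icc 1 D, y g * if g = f then 1 else 0 := by
          rw [Finset.sum_comm]
          refine Finset.sum_congr rfl fun g hg => ?_
          rw [← Finset.mul_sum, sum_moebius_div_between (Finset.mem_Icc.mp hf).1 hg]
      _ = y f := by simp [Finset.mem_Icc.mp hf]
  have hQ : ∑ d ∈ Finset.Icc 1 D, ∑ e ∈ Finset.Icc 1 D, w d * w e / Nat.lcm d e = 1 / S := by
    calc _ = ∑ d ∈ Finset.Icc 1 D, ∑ e ∈ Finset.Icc 1 D, ∑ f ∈ Finset.Icc 1 D,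
          (Nat.totient f : ℝ) * ((w d * (if f ∣ d then (1 : ℝ) / d else 0)) *
            (w e * (if f ∣ e then (1 : ℝ) / e else 0))) := by
          refine Finset.sum_congr rfl fun d hd => Finset.sum_congr rfl fun e he => ?_
          rw [div_eq_mul_one_div, one_div_lcm_eq_sum_totient hd he, Finset.mul_sum]
          refine Finset.sum_congr rfl fun f _ => ?_
          ring
      _ = ∑ f ∈ Finset.Icc 1 D, (Nat.totient f : ℝ) * (y f * y f) := by
          simp_rw [Finset.sum_comm (s := Finset.Icc 1 D) (t := Finset.Icc 1 D)
            (f := fun e f => (Nat.totient f : ℝ) * ((w _ * (if f ∣ _ then (1 : ℝ) / _ else 0)) *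
            (w e * (if f ∣ e then (1 : ℝ) / e else 0))))]
          rw [Finset.sum_comm]
          refine Finset.sum_congr rfl fun f hf => ?_
          conv_rhs => rw [← hinv f hf]
          rw [Finset.sum_mul_sum, Finset.mul_sum]
          refine Finset.sum_congr rfl fun d _ => ?_
          rw [Finset.mul_sum]
      _ = ∑ f ∈ Finset.Icc 1 D, ((moebius f : ℝ) ^ 2 / (Nat.totient f : ℝ)) * (1 / S ^ 2) := by
          refine Finset.sum_congr rfl fun f hf => ?_
          have : (0 : ℝ) < Nat.totient f := by
            exact_mod_cast Nat.totient_pos.mpr (Finset.mem_Icc.mp hf).1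
          simp only [hy]
          field_simp
      _ = 1 / S := by
          rw [← Finset.sum_mul, ← hSdef]
          field_simp
  refine ⟨w, ?_, ?_, ?_, ?_⟩
  · simp only [hw, Nat.cast_one, one_mul, one_dvd, if_true, Nat.div_one]
    calc _ = ∑ f ∈ Finset.Icc 1 D, ((moebius f : ℝ) ^ 2 / (Nat.totient f : ℝ)) * (1 / S) := by
          refine Finset.sum_congr rfl fun f _ => ?_
          simp only [hy]
          rw [div_mul_div_comm, mul_one, ← mul_div_assoc, sq]
      _ = 1 := by
          rw [← Finset.sum_mul, ← hSdef]
          field_simp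
  · intro d hd
    have hdD : (d : ℝ) ≤ D := by exact_mod_cast (Finset.mem_Icc.mp hd).2
    simp only [hw]
    rw [abs_mul, Nat.abs_cast]
    have : |∑ g ∈ Finset.Icc 1 D, if d ∣ g then (moebius (g / d) : ℝ) * y g else 0| ≤ 1 := by
      refine (Finset.abs_sum_le_sum_abs _ _).trans ?_
      calc _ ≤ ∑ f ∈ Finset.Icc 1 D, ((moebius f : ℝ) ^ 2 / (Nat.totient f : ℝ)) * (1 / S) := by
            refine Finset.sum_le_sum fun g hg => ?_
            have hμ : |(moebius (g / d) : ℝ)| ≤ 1 := by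
              exact_mod_cast (abs_moebius_le_one (n := g / d))
            have hyg : |y g| = ((moebius g : ℝ) ^ 2 / (Nat.totient g : ℝ)) * (1 / S) := by
              have hm : |(moebius g : ℝ)| = (moebius g : ℝ) ^ 2 := by
                rcases moebius_eq_or g with h | h | h <;> simp [h]
              simp only [hy]
              rw [abs_div, abs_mul, Nat.abs_cast, abs_of_pos hSpos, hm, div_mul_div_comm, mul_one]
            rw [← hyg]
            split_ifs
            · rw [abs_mul]
              exact mul_le_of_le_one_left (abs_nonneg _) hμ
            · simp
        _ = 1 := by
            rw [← Finset.sum_mul, ← hSdef]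
            field_simp
    calc _ ≤ (d : ℝ) * 1 := by gcongr
      _ ≤ D := by linarith
  · rw [hQ]
    positivity
  · rw [hQ, div_le_div_iff₀ hSpos hlog]
    linarith

/-- For a reduced fraction `a / q`, translating by `k / q` increases the sum of floors by `k`. -/
theorem sum_floor_add_div (u : ℝ) {a : ℤ} {q : ℕ} (hq : 0 < q) (hcop : IsCoprime a q) (k : ℤ) :
    ∑ j ∈ Finset.range q, ⌊u + k / q + j * (a / q)⌋ =
      ∑ j ∈ Finset.range q, ⌊u + j * ((a : ℝ) / q)⌋ + k := by
  have hq0 : (q : ℝ) ≠ 0 := by positivity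
  have hshift : ∀ (v : ℝ) (b : ℕ), ∑ j ∈ Finset.range q, ⌊v + (j + b : ℕ) * ((a : ℝ) / q)⌋ =
      ∑ j ∈ Finset.range q, ⌊v + j * ((a : ℝ) / q)⌋ + b * a := by
    intro v b
    induction b with
    | zero => simp
    | succ b ih =>
      have h1 := Finset.sum_range_succ (fun j : ℕ => ⌊v + (j + b : ℕ) * ((a : ℝ) / q)⌋) q
      have h2 := Finset.sum_range_succ' (fun j : ℕ => ⌊v + (j + b : ℕ) * ((a : ℝ) / q)⌋) q
      have h3 : ⌊v + (q + b : ℕ) * ((a : ℝ) / q)⌋ = ⌊v + (0 + b : ℕ) * ((a : ℝ) / q)⌋ + a := by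
        rw [← Int.floor_add_intCast]
        congr 1
        push_cast
        field_simp
        ring
      have h4 : ∀ j, j + 1 + b = j + (b + 1) := fun j => by ring
      simp only [h4] at h2
      push_cast at *
      linarith
  obtain ⟨s, t, hst⟩ := hcop
  obtain ⟨b, c, hbc⟩ : ∃ (b : ℕ) (c : ℤ), (b : ℤ) * a = k + q * c := by
    refine ⟨(k * s % q).toNat, -(k * t) - (k * s / q) * a, ?_⟩
    rw [Int.toNat_of_nonneg (Int.emod_nonneg _ (by lia)), Int.emod_def]
    linear_combination k * hst
  have h := hshift (u - c) b
  have hc : ∀ z : ℝ, ⌊u - c + z⌋ = ⌊u + z⌋ - c := fun z => by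
    rw [← Int.floor_sub_intCast]
    congr 1
    ring
  have hl : ∀ j : ℕ, ⌊u - c + (j + b : ℕ) * ((a : ℝ) / q)⌋ = ⌊u + k / q + j * ((a : ℝ) / q)⌋ := by
    intro j
    congr 1
    have : (b : ℝ) * a = k + q * c := by exact_mod_cast hbc
    push_cast
    field_simp
    linear_combination this
  simp only [hl, hc, Finset.sum_sub_distrib, Finset.sum_const, Finset.card_range,
    nsmul_eq_mul] at h
  linarith

theorem floor_sub_floor_sub_eq (t : ℝ) {s : ℝ} (hs0 : 0 ≤ s) (hs1 : s ≤ 1) :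
    ⌊t⌋ - ⌊t - s⌋ = if Int.fract t < s then 1 else 0 := by
  have h1 := Int.floor_add_fract t
  have h2 := Int.fract_nonneg t
  have h3 := Int.fract_lt_one t
  split_ifs with h
  · have : ⌊t - s⌋ = ⌊t⌋ - 1 := by
      rw [Int.floor_eq_iff]
      push_cast
      constructor <;> linarith
    lia
  · have : ⌊t - s⌋ = ⌊t⌋ := by
      rw [Int.floor_eq_iff]
      constructor <;> linarith
    lia

/-- Equidistribution over a block whose length is the denominator of a good approximation. -/
theorem abs_sum_block_sub_le {θ γ s : ℝ} {a : ℤ} {q : ℕ} (hq : 0 < q) (hcop : IsCoprime a q)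
    (hθ : |θ - a / q| ≤ 1 / (q : ℝ) ^ 2) (hs0 : 0 ≤ s) (hs1 : s ≤ 1) :
    |∑ j ∈ Finset.range q, (if Int.fract (θ * j + γ) < s then (1 : ℝ) else 0) - s * q| ≤ 4 := by
  have hqpos : (0 : ℝ) < q := by exact_mod_cast hq
  set F : ℝ → ℤ := fun u => ∑ j ∈ Finset.range q, ⌊u + j * ((a : ℝ) / q)⌋ with hF
  have hFmono : Monotone F := fun u v huv => Finset.sum_le_sum fun j _ => by gcongr
  have hFshift : ∀ (u : ℝ) (k : ℤ), F (u + k / q) = F u + k := fun u k =>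
    sum_floor_add_div u hq hcop k
  have hFupper : ∀ u v : ℝ, (F v : ℝ) - F u ≤ q * (v - u) + 1 := by
    intro u v
    have h1 : v ≤ u + (⌈q * (v - u)⌉ : ℤ) / q := by
      have := Int.le_ceil (q * (v - u))
      rw [← sub_le_iff_le_add', le_div_iff₀ hqpos]
      linarith
    have h2 := hFmono h1
    rw [hFshift] at h2
    have h3 : (F v : ℝ) ≤ F u + ⌈q * (v - u)⌉ := by exact_mod_cast h2
    have h4 := Int.ceil_lt_add_one (q * (v - u))
    linarith
  have hFlower : ∀ u v : ℝ, q * (v - u) - 1 ≤ (F v : ℝ) - F u := by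
    intro u v
    have := hFupper v u
    linarith
  have herr : ∀ j ∈ Finset.range q, |θ * j - j * ((a : ℝ) / q)| ≤ 1 / q := by
    intro j hj
    have hjq : (j : ℝ) ≤ q := by exact_mod_cast (Finset.mem_range.mp hj).le
    have : θ * j - j * ((a : ℝ) / q) = j * (θ - a / q) := by ring
    rw [this, abs_mul, Nat.abs_cast]
    calc (j : ℝ) * |θ - a / q| ≤ q * (1 / (q : ℝ) ^ 2) := by gcongr
      _ = 1 / q := by field_simp
  have hlow : ∀ c : ℝ, F (c - 1 / q) ≤ ∑ j ∈ Finset.range q, ⌊θ * j + c⌋ := fun c =>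
    Finset.sum_le_sum fun j hj => by
      have := abs_le.mp (herr j hj)
      exact Int.floor_le_floor (by linarith)
  have hupp : ∀ c : ℝ, ∑ j ∈ Finset.range q, ⌊θ * j + c⌋ ≤ F (c + 1 / q) := fun c =>
    Finset.sum_le_sum fun j hj => by
      have := abs_le.mp (herr j hj)
      exact Int.floor_le_floor (by linarith)
  have hsum : ∑ j ∈ Finset.range q, (if Int.fract (θ * j + γ) < s then (1 : ℝ) else 0) =
      ((∑ j ∈ Finset.range q, ⌊θ * j + γ⌋ : ℤ) : ℝ) -
        ((∑ j ∈ Finset.range q, ⌊θ * j + (γ - s)⌋ : ℤ) : ℝ) := by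
    rw [← Int.cast_sub, ← Finset.sum_sub_distrib, Int.cast_sum]
    refine Finset.sum_congr rfl fun j _ => ?_
    rw [← add_sub_assoc, floor_sub_floor_sub_eq _ hs0 hs1]
    split_ifs <;> simp
  rw [hsum]
  have a1 : (F (γ - 1 / q) : ℝ) ≤ (∑ j ∈ Finset.range q, ⌊θ * j + γ⌋ : ℤ) := by
    exact_mod_cast hlow γ
  have a2 : ((∑ j ∈ Finset.range q, ⌊θ * j + γ⌋ : ℤ) : ℝ) ≤ F (γ + 1 / q) := by
    exact_mod_cast hupp γ
  have a3 : (F (γ - s - 1 / q) : ℝ) ≤ (∑ j ∈ Finset.range q, ⌊θ * j + (γ - s)⌋ : ℤ) := by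
    exact_mod_cast hlow (γ - s)
  have a4 : ((∑ j ∈ Finset.range q, ⌊θ * j + (γ - s)⌋ : ℤ) : ℝ) ≤ F (γ - s + 1 / q) := by
    exact_mod_cast hupp (γ - s)
  have e1 := hFupper (γ - s - 1 / q) (γ + 1 / q)
  have e2 := hFlower (γ - s + 1 / q) (γ - 1 / q)
  have e3 : q * (γ + 1 / q - (γ - s - 1 / q)) = s * q + 2 := by field_simp; ring
  have e4 : q * (γ - 1 / q - (γ - s + 1 / q)) = s * q - 2 := by field_simp; ring
  rw [e3] at e1
  rw [e4] at e2
  rw [abs_le]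
  constructor <;> linarith

theorem abs_sum_range_sub_le {θ γ s : ℝ} {a : ℤ} {q : ℕ} (hq : 0 < q) (hcop : IsCoprime a q)
    (hθ : |θ - a / q| ≤ 1 / (q : ℝ) ^ 2) (hs0 : 0 ≤ s) (hs1 : s ≤ 1) (M : ℕ) :
    |∑ j ∈ Finset.range M, (if Int.fract (θ * j + γ) < s then (1 : ℝ) else 0) - s * M| ≤
      4 * (M / q) + q := by
  have hqpos : (0 : ℝ) < q := by exact_mod_cast hq
  set g : ℕ → ℝ := fun j => if Int.fract (θ * j + γ) < s then (1 : ℝ) else 0 with hg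
  have hblocks : ∀ k : ℕ, |∑ j ∈ Finset.range (k * q), g j - s * (k * q : ℕ)| ≤ 4 * k := by
    intro k
    induction k with
    | zero => simp
    | succ k ih =>
      have h1 := abs_sum_block_sub_le (γ := θ * (k * q : ℕ) + γ) hq hcop hθ hs0 hs1
      have h2 : ∑ j ∈ Finset.range ((k + 1) * q), g j = ∑ j ∈ Finset.range (k * q), g j +
          ∑ j ∈ Finset.range q,
            (if Int.fract (θ * j + (θ * (k * q : ℕ) + γ)) < s then (1 : ℝ) else 0) := by
        rw [add_mul, one_mul, Finset.sum_range_add]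
        congr 1
        refine Finset.sum_congr rfl fun j _ => ?_
        simp only [hg]
        congr 3
        push_cast
        ring
      rw [h2]
      rw [abs_le] at *
      push_cast at *
      constructor <;> linarith
  have hM := Nat.div_add_mod' M q
  have hrem : |∑ j ∈ Finset.range (M % q), g (M / q * q + j) - s * (M % q : ℕ)| ≤ q := by
    have hr : ((M % q : ℕ) : ℝ) ≤ q := by exact_mod_cast (Nat.mod_lt M hq).le
    have h0 : 0 ≤ ∑ j ∈ Finset.range (M % q), g (M / q * q + j) :=
      Finset.sum_nonneg fun j _ => by simp only [hg]; positivity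
    have h1 : ∑ j ∈ Finset.range (M % q), g (M / q * q + j) ≤ (M % q : ℕ) := by
      calc _ ≤ ∑ j ∈ Finset.range (M % q), (1 : ℝ) :=
            Finset.sum_le_sum fun j _ => by simp only [hg]; split_ifs <;> norm_num
        _ = _ := by simp
    have h2 : s * (M % q : ℕ) ≤ (M % q : ℕ) := mul_le_of_le_one_left (by positivity) hs1
    have h3 : 0 ≤ s * (M % q : ℕ) := by positivity
    rw [abs_le]
    constructor <;> linarith
  have hsplit : ∑ j ∈ Finset.range M, g j = ∑ j ∈ Finset.range (M / q * q), g j +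
      ∑ j ∈ Finset.range (M % q), g (M / q * q + j) := by
    rw [← Finset.sum_range_add, hM]
  have hcast : (M : ℝ) = (M / q * q : ℕ) + (M % q : ℕ) := by exact_mod_cast hM.symm
  have hdiv : ((M / q : ℕ) : ℝ) ≤ M / q := Nat.cast_div_le
  have hb := abs_le.mp (hblocks (M / q))
  have hr := abs_le.mp hrem
  rw [hsplit, abs_le]
  have : s * (M : ℝ) = s * (M / q * q : ℕ) + s * (M % q : ℕ) := by rw [← mul_add, ← hcast]
  rw [this]
  constructor <;> linarith

theorem dvd_floor_iff_fract_div_lt (t : ℝ) {e : ℕ} (he : 0 < e) :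
    (e : ℤ) ∣ ⌊t⌋ ↔ Int.fract (t / e) < 1 / e := by
  have he' : (0 : ℝ) < e := by exact_mod_cast he
  have h1 := Int.floor_le t
  have h2 := Int.lt_floor_add_one t
  constructor
  · rintro ⟨k, hk⟩
    rw [hk] at h1 h2
    push_cast at h1 h2
    have hfl : ⌊t / e⌋ = k := by
      rw [Int.floor_eq_iff, le_div_iff₀ he', div_lt_iff₀ he']
      have : (1 : ℝ) ≤ e := by exact_mod_cast he
      constructor <;> linarith
    rw [Int.fract, hfl, sub_lt_iff_lt_add, div_lt_iff₀ he', add_mul, one_div_mul_cancel he'.ne']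
    linarith
  · intro h
    refine ⟨⌊t / e⌋, ?_⟩
    rw [Int.fract, sub_lt_iff_lt_add, div_lt_iff₀ he', add_mul, one_div_mul_cancel he'.ne'] at h
    have h3 := Int.floor_le (t / e)
    rw [le_div_iff₀ he'] at h3
    rw [Int.floor_eq_iff]
    push_cast
    constructor <;> linarith

/-- Joint equidistribution of `n` and `⌊α n + β⌋` in residue classes. -/
theorem abs_card_dvd_dvd_floor_sub_le {α β : ℝ} {d e q X : ℕ} {a : ℤ} (hd : 0 < d) (he : 0 < e)
    (hq : 0 < q) (hcop : IsCoprime a q) (hα : |α * d / e - a / q| ≤ 1 / (q : ℝ) ^ 2) :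
    |(((Finset.Icc 1 X).filter fun n : ℕ => d ∣ n ∧ (e : ℤ) ∣ ⌊α * n + β⌋).card : ℝ) -
      X * (1 / d * (1 / e))| ≤ 4 * (X / q) + q + 1 := by
  have hd' : (0 : ℝ) < d := by exact_mod_cast hd
  have hd1 : (1 : ℝ) ≤ d := by exact_mod_cast hd
  have he' : (0 : ℝ) < e := by exact_mod_cast he
  have he1 : (1 : ℝ) ≤ e := by exact_mod_cast he
  have hq' : (0 : ℝ) < q := by exact_mod_cast hq
  set M := X / d with hMdef
  have hcard : (((Finset.Icc 1 X).filter fun n : ℕ => d ∣ n ∧ (e : ℤ) ∣ ⌊α * n + β⌋).card : ℝ) =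
      ∑ j ∈ Finset.range M, (if Int.fract (α * d / e * j + (α * d + β) / e) < 1 / e
        then (1 : ℝ) else 0) := by
    rw [← Finset.sum_filter, Finset.sum_const, nsmul_eq_mul, mul_one]
    congr 1
    symm
    refine Finset.card_bij (fun j _ => d * (j + 1)) ?_ ?_ ?_
    · intro j hj
      simp only [Finset.mem_filter, Finset.mem_range, Finset.mem_Icc] at hj ⊢
      refine ⟨⟨Nat.mul_pos hd (Nat.succ_pos j), ?_⟩, dvd_mul_right _ _, ?_⟩
      · have : j + 1 ≤ X / d := hj.1
        rw [mul_comm]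
        exact (Nat.le_div_iff_mul_le hd).mp this
      · rw [dvd_floor_iff_fract_div_lt _ he]
        convert hj.2 using 2
        push_cast
        ring
    · intro i _ j _ hij
      have := Nat.eq_of_mul_eq_mul_left hd hij
      lia
    · intro n hn
      simp only [Finset.mem_filter, Finset.mem_Icc] at hn
      obtain ⟨⟨h1, h2⟩, ⟨k, rfl⟩, h3⟩ := hn
      have hk : 0 < k := Nat.pos_of_ne_zero (by rintro rfl; simp at h1)
      refine ⟨k - 1, ?_, by rw [Nat.sub_add_cancel hk]⟩
      simp only [Finset.mem_filter, Finset.mem_range]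
      have hkM : k ≤ M := (Nat.le_div_iff_mul_le hd).mpr (by rwa [mul_comm])
      refine ⟨by lia, ?_⟩
      rw [dvd_floor_iff_fract_div_lt _ he] at h3
      convert h3 using 2
      rw [Nat.cast_sub hk]
      push_cast
      ring
  rw [hcard]
  have hs1 : (1 : ℝ) / e ≤ 1 := by rw [div_le_one he']; exact he1
  have h := abs_sum_range_sub_le (γ := (α * d + β) / e) hq hcop hα (by positivity) hs1 M
  have hM1 : (M : ℝ) ≤ X / d := Nat.cast_div_le
  have hM2 : (X : ℝ) / d - 1 ≤ M := by
    have : (X : ℝ) / d < M + 1 := by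
      rw [div_lt_iff₀ hd']
      have := Nat.lt_mul_div_succ X hd
      rw [← hMdef, mul_comm] at this
      exact_mod_cast this
    linarith
  have hMX : (M : ℝ) ≤ X := by exact_mod_cast Nat.div_le_self X d
  have hMq : (M : ℝ) / q ≤ X / q := by gcongr
  have hmain : |1 / (e : ℝ) * M - X * (1 / d * (1 / e))| ≤ 1 := by
    have : 1 / (e : ℝ) * M - X * (1 / d * (1 / e)) = 1 / e * (M - X / d) := by ring
    rw [this, abs_mul, abs_of_pos (by positivity)]
    have h1 : |(M : ℝ) - X / d| ≤ 1 := by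
      rw [abs_le]
      constructor <;> linarith
    exact mul_le_one₀ hs1 (abs_nonneg _) h1
  rw [abs_le] at *
  constructor <;> linarith

/-- A product of two one-dimensional `Λ²` sieves, applied to `n` and `f n` simultaneously. -/
theorem sum_sq_mul_sq_le {X D : ℕ} {E : ℝ} (f : ℕ → ℤ) (w : ℕ → ℝ)
    (hw : ∀ d ∈ Finset.Icc 1 D, |w d| ≤ D)
    (hE : ∀ d ∈ Finset.Icc 1 (D ^ 2), ∀ e ∈ Finset.Icc 1 (D ^ 2),
      |(((Finset.Icc 1 X).filter fun n : ℕ => d ∣ n ∧ (e : ℤ) ∣ f n).card : ℝ) -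
        X * (1 / d * (1 / e))| ≤ E) :
    ∑ n ∈ Finset.Icc 1 X, (∑ d ∈ Finset.Icc 1 D, if d ∣ n then w d else 0) ^ 2 *
        (∑ d ∈ Finset.Icc 1 D, if (d : ℤ) ∣ f n then w d else 0) ^ 2 ≤
      X * (∑ d ∈ Finset.Icc 1 D, ∑ e ∈ Finset.Icc 1 D, w d * w e / Nat.lcm d e) ^ 2 +
        (D : ℝ) ^ 8 * E := by
  set I := Finset.Icc 1 D
  set P := (I ×ˢ I) ×ˢ (I ×ˢ I) with hP
  set v : ℕ × ℕ → ℝ := fun p => w p.1 * w p.2 with hv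
  set l : ℕ × ℕ → ℕ := fun p => Nat.lcm p.1 p.2 with hl
  set N : (ℕ × ℕ) × (ℕ × ℕ) → ℝ := fun p =>
    (((Finset.Icc 1 X).filter fun n : ℕ => l p.1 ∣ n ∧ (l p.2 : ℤ) ∣ f n).card : ℝ) with hN
  have hsq1 : ∀ n : ℕ, (∑ d ∈ I, if d ∣ n then w d else 0) ^ 2 =
      ∑ p ∈ I ×ˢ I, if l p ∣ n then v p else 0 := by
    intro n
    rw [sq, Finset.sum_mul_sum, Finset.sum_product]
    refine Finset.sum_congr rfl fun d _ => Finset.sum_congr rfl fun e _ => ?_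
    simp only [hl, hv, Nat.lcm_dvd_iff]
    by_cases h1 : d ∣ n <;> by_cases h2 : e ∣ n <;> simp [h1, h2]
  have hsq2 : ∀ n : ℤ, (∑ d ∈ I, if (d : ℤ) ∣ n then w d else 0) ^ 2 =
      ∑ p ∈ I ×ˢ I, if (l p : ℤ) ∣ n then v p else 0 := by
    intro n
    have := hsq1 n.natAbs
    simpa only [← Int.natCast_dvd] using this
  have hlhs : ∑ n ∈ Finset.Icc 1 X, (∑ d ∈ I, if d ∣ n then w d else 0) ^ 2 *
        (∑ d ∈ I, if (d : ℤ) ∣ f n then w d else 0) ^ 2 =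
      ∑ p ∈ P, v p.1 * v p.2 * N p := by
    have hprod : ∀ n ∈ Finset.Icc 1 X, (∑ d ∈ I, if d ∣ n then w d else 0) ^ 2 *
        (∑ d ∈ I, if (d : ℤ) ∣ f n then w d else 0) ^ 2 = ∑ p ∈ P,
          (if l p.1 ∣ n then v p.1 else 0) * (if (l p.2 : ℤ) ∣ f n then v p.2 else 0) := by
      intro n _
      rw [hsq1, hsq2, Finset.sum_mul_sum, ← Finset.sum_product']
    rw [Finset.sum_congr rfl hprod, Finset.sum_comm]
    refine Finset.sum_congr rfl fun p _ => ?_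
    simp only [hN]
    rw [← Finset.sum_boole, Finset.mul_sum]
    refine Finset.sum_congr rfl fun n _ => ?_
    by_cases h1 : l p.1 ∣ n <;> by_cases h2 : (l p.2 : ℤ) ∣ f n <;> simp [h1, h2]
  have hmain : X * (∑ d ∈ I, ∑ e ∈ I, w d * w e / Nat.lcm d e) ^ 2 =
      ∑ p ∈ P, v p.1 * v p.2 * (X * (1 / (l p.1 : ℝ) * (1 / (l p.2 : ℝ)))) := by
    rw [← Finset.sum_product', sq, Finset.sum_mul_sum, ← Finset.sum_product', Finset.mul_sum]
    refine Finset.sum_congr rfl fun p _ => ?_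
    simp only [hv, hl]
    ring
  rw [hlhs, hmain, ← sub_le_iff_le_add', ← Finset.sum_sub_distrib]
  have hvle : ∀ p ∈ I ×ˢ I, |v p| ≤ (D : ℝ) ^ 2 := by
    intro p hp
    rw [Finset.mem_product] at hp
    simp only [hv]
    rw [abs_mul, sq]
    exact mul_le_mul (hw _ hp.1) (hw _ hp.2) (abs_nonneg _) (by positivity)
  have hlmem : ∀ p ∈ I ×ˢ I, l p ∈ Finset.Icc 1 (D ^ 2) := by
    intro p hp
    rw [Finset.mem_product, Finset.mem_Icc, Finset.mem_Icc] at hp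
    rw [Finset.mem_Icc]
    refine ⟨Nat.lcm_pos hp.1.1 hp.2.1, ?_⟩
    calc l p ≤ p.1 * p.2 := Nat.le_of_dvd (Nat.mul_pos hp.1.1 hp.2.1) (Nat.lcm_dvd_mul _ _)
      _ ≤ D * D := Nat.mul_le_mul hp.1.2 hp.2.2
      _ = D ^ 2 := (sq D).symm
  calc _ ≤ ∑ p ∈ P, (D : ℝ) ^ 4 * E := by
        refine Finset.sum_le_sum fun p hp => ?_
        rw [hP, Finset.mem_product] at hp
        rw [← mul_sub]
        refine (le_abs_self _).trans ?_
        rw [abs_mul, abs_mul]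
        calc _ ≤ ((D : ℝ) ^ 2 * (D : ℝ) ^ 2) * E := by
              gcongr
              · exact hvle _ hp.1
              · exact hvle _ hp.2
              · exact hE _ (hlmem _ hp.1) _ (hlmem _ hp.2)
          _ = _ := by ring
    _ = (D : ℝ) ^ 8 * E := by
        rw [Finset.sum_const, hP]
        simp only [Finset.card_product, I, Nat.card_Icc, Nat.add_sub_cancel, nsmul_eq_mul]
        push_cast
        ring

theorem sum_dvd_prime_eq {D p : ℕ} (hD : 1 ≤ D) (hp : p.Prime) (hDp : D < p) (w : ℕ → ℝ) :
    (∑ d ∈ Finset.Icc 1 D, if d ∣ p then w d else 0) = w 1 := by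
  rw [Finset.sum_eq_single_of_mem 1 (Finset.mem_Icc.mpr ⟨le_rfl, hD⟩)]
  · simp
  · intro d hd hd1
    rw [Finset.mem_Icc] at hd
    refine if_neg fun h => ?_
    rcases (Nat.dvd_prime hp).mp h with h | h <;> lia

/-- The reals close to a rational with small denominator. -/
noncomputable def nearRational (B y : ℝ) : Set ℝ :=
  ⋃ q ∈ Finset.Icc 1 ⌊y ^ 12⌋₊, ⋃ a ∈ Finset.Icc (-⌈(B + 1) * y ^ 12⌉) ⌈(B + 1) * y ^ 12⌉,
    Metric.closedBall ((a : ℝ) / (q : ℕ)) (y ^ 48)⁻¹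

theorem measurableSet_nearRational (B y : ℝ) : MeasurableSet (nearRational B y) :=
  Finset.measurableSet_biUnion _ fun _ _ =>
    Finset.measurableSet_biUnion _ fun _ _ => measurableSet_closedBall

theorem volume_nearRational_le {B y : ℝ} (hB : 0 ≤ B) (hy : 1 ≤ y) :
    volume (nearRational B y) ≤ ENNReal.ofReal ((4 * B + 10) * (y ^ 24)⁻¹) := by
  have hy0 : 0 < y := by linarith
  set A := ⌈(B + 1) * y ^ 12⌉ with hA
  have hA0 : 0 ≤ A := Int.ceil_nonneg (by positivity)
  have hA1 : (A : ℝ) < (B + 1) * y ^ 12 + 1 := Int.ceil_lt_add_one _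
  have hcard : (((Finset.Icc (-A) A).card : ℕ) : ℝ) = 2 * A + 1 := by
    have : (((Finset.Icc (-A) A).card : ℕ) : ℤ) = 2 * A + 1 := by
      rw [Int.card_Icc]
      lia
    exact_mod_cast this
  have hK : ((⌊y ^ 12⌋₊ : ℕ) : ℝ) ≤ y ^ 12 := Nat.floor_le (by positivity)
  have h12 : 1 ≤ y ^ 12 := one_le_pow₀ hy
  calc volume (nearRational B y)
      ≤ ∑ q ∈ Finset.Icc 1 ⌊y ^ 12⌋₊, ∑ a ∈ Finset.Icc (-A) A,
          volume (Metric.closedBall ((a : ℝ) / (q : ℕ)) (y ^ 48)⁻¹) := by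
        refine (measure_biUnion_finset_le _ _).trans ?_
        exact Finset.sum_le_sum fun q _ => measure_biUnion_finset_le _ _
    _ = ENNReal.ofReal ((⌊y ^ 12⌋₊ : ℕ) * ((2 * A + 1) * (2 * (y ^ 48)⁻¹))) := by
        simp only [Real.volume_closedBall, Finset.sum_const, Nat.card_Icc, Nat.add_sub_cancel]
        rw [← ENNReal.ofReal_nsmul, ← ENNReal.ofReal_nsmul, nsmul_eq_mul, nsmul_eq_mul, hcard]
    _ ≤ _ := by
        refine ENNReal.ofReal_le_ofReal ?_
        have hA2 : 2 * (A : ℝ) + 1 ≤ (2 * B + 5) * y ^ 12 := by nlinarith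
        have hA3 : (0 : ℝ) ≤ A := by exact_mod_cast hA0
        calc _ ≤ y ^ 12 * (((2 * B + 5) * y ^ 12) * (2 * (y ^ 48)⁻¹)) := by gcongr
          _ = _ := by
            field_simp
            ring

theorem exists_approx_of_notMem_nearRational {B y α : ℝ} (hy : 1 ≤ y) (hα0 : 0 < α)
    (hαB : α < B) (hα : α ∉ nearRational B y) {d e : ℕ} (hd : d ∈ Finset.Icc 1 (⌊y⌋₊ ^ 2))
    (he : e ∈ Finset.Icc 1 (⌊y⌋₊ ^ 2)) :
    ∃ (a : ℤ) (q : ℕ), 0 < q ∧ IsCoprime a q ∧ |α * d / e - a / q| ≤ 1 / (q : ℝ) ^ 2 ∧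
      y ^ 10 ≤ q ∧ (q : ℝ) ≤ y ^ 50 := by
  have hy0 : 0 < y := by linarith
  rw [Finset.mem_Icc] at hd he
  have hfl : ((⌊y⌋₊ : ℕ) : ℝ) ≤ y := Nat.floor_le hy0.le
  have hd1 : (1 : ℝ) ≤ d := by exact_mod_cast hd.1
  have he1 : (1 : ℝ) ≤ e := by exact_mod_cast he.1
  have hdy : (d : ℝ) ≤ y ^ 2 := by
    calc (d : ℝ) ≤ ((⌊y⌋₊ : ℕ) : ℝ) ^ 2 := by exact_mod_cast hd.2
      _ ≤ y ^ 2 := by gcongr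
  have hey : (e : ℝ) ≤ y ^ 2 := by
    calc (e : ℝ) ≤ ((⌊y⌋₊ : ℕ) : ℝ) ^ 2 := by exact_mod_cast he.2
      _ ≤ y ^ 2 := by gcongr
  set n := ⌊y ^ 50⌋₊ with hn
  have hn1 : 1 ≤ n := Nat.le_floor (by exact_mod_cast one_le_pow₀ hy)
  have hny : (n : ℝ) ≤ y ^ 50 := Nat.floor_le (by positivity)
  have hyn : y ^ 50 ≤ n + 1 := (Nat.lt_floor_add_one _).le
  obtain ⟨r, hr, hrn⟩ := Real.exists_rat_abs_sub_le_and_den_le (α * d / e) hn1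
  have hqpos : 0 < r.den := r.pos
  have hq1 : (1 : ℝ) ≤ r.den := by exact_mod_cast hqpos
  have hqn : (r.den : ℝ) ≤ n := by exact_mod_cast hrn
  rw [Rat.cast_def] at hr
  refine ⟨r.num, r.den, hqpos, ?_, ?_, ?_, hqn.trans hny⟩
  · rw [Int.isCoprime_iff_gcd_eq_one]
    exact r.reduced
  · refine hr.trans ?_
    rw [sq]
    gcongr
    linarith
  · by_contra! hlt
    apply hα
    have hdist : |((r.num * e : ℤ) : ℝ) / ((r.den * d : ℕ) : ℝ) - α| ≤ (y ^ 48)⁻¹ := by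
      have h1 : α - ((r.num * e : ℤ) : ℝ) / ((r.den * d : ℕ) : ℝ) =
          (e / d) * (α * d / e - r.num / r.den) := by
        push_cast
        field_simp
      rw [abs_sub_comm, h1, abs_mul, abs_of_pos (by positivity)]
      calc (e : ℝ) / d * |α * d / e - r.num / r.den|
          ≤ y ^ 2 / 1 * (1 / (y ^ 50 * 1)) := by
            refine mul_le_mul (by gcongr) (hr.trans (by gcongr)) (abs_nonneg _) (by positivity)
        _ = (y ^ 48)⁻¹ := by field_simp
    have hqd : ((r.den * d : ℕ) : ℝ) ≤ y ^ 12 := by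
      push_cast
      calc (r.den : ℝ) * d ≤ y ^ 10 * y ^ 2 := by gcongr
        _ = y ^ 12 := by ring
    have hqd0 : (0 : ℝ) < ((r.den * d : ℕ) : ℝ) := by
      push_cast
      positivity
    have hsmall : (y ^ 48)⁻¹ ≤ 1 := inv_le_one_of_one_le₀ (one_le_pow₀ hy)
    have hnum : |((r.num * e : ℤ) : ℝ)| ≤ (B + 1) * y ^ 12 := by
      have h2 : |((r.num * e : ℤ) : ℝ) / ((r.den * d : ℕ) : ℝ)| ≤ B + 1 := by
        rw [abs_le] at hdist ⊢
        constructor <;> linarith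
      rw [abs_div, abs_of_pos hqd0, div_le_iff₀ hqd0] at h2
      refine h2.trans ?_
      have : 0 ≤ B + 1 := by linarith
      gcongr
    simp only [nearRational, Set.mem_iUnion]
    refine ⟨r.den * d, Finset.mem_Icc.mpr ⟨Nat.mul_pos hqpos hd.1, Nat.le_floor hqd⟩,
      r.num * e, ?_, ?_⟩
    · rw [abs_le] at hnum
      rw [Finset.mem_Icc]
      constructor
      · rw [neg_le]
        have : (((-(r.num * e) : ℤ)) : ℝ) ≤ (⌈(B + 1) * y ^ 12⌉ : ℤ) := by
          refine le_trans ?_ (Int.le_ceil _)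
          push_cast at hnum ⊢
          linarith
        exact_mod_cast this
      · have : ((r.num * e : ℤ) : ℝ) ≤ (⌈(B + 1) * y ^ 12⌉ : ℤ) := hnum.2.trans (Int.le_ceil _)
        exact_mod_cast this
    · rw [Metric.mem_closedBall, dist_comm, Real.dist_eq]
      exact hdist

theorem piStar_le_of_equidistribution {α β x y E : ℝ} {w : ℕ → ℝ} (hy : 1 ≤ y) (hα : 0 < α)
    (hlarge : y + 1 ≤ α * y ^ 2 + β) (hw1 : w 1 = 1)
    (hE : ∑ n ∈ Finset.Icc 1 ⌊x⌋₊,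
      (∑ d ∈ Finset.Icc 1 ⌊y⌋₊, if d ∣ n then w d else 0) ^ 2 *
        (∑ d ∈ Finset.Icc 1 ⌊y⌋₊, if (d : ℤ) ∣ ⌊α * n + β⌋ then w d else 0) ^ 2 ≤ E) :
    (piStar α β x : ℝ) ≤ y ^ 2 + E := by
  classical
  have hy0 : 0 < y := by linarith
  have hD : 1 ≤ ⌊y⌋₊ := Nat.le_floor (by exact_mod_cast hy)
  have hDy : ((⌊y⌋₊ : ℕ) : ℝ) ≤ y := Nat.floor_le hy0.le
  set F : ℕ → ℝ := fun n => (∑ d ∈ Finset.Icc 1 ⌊y⌋₊, if d ∣ n then w d else 0) ^ 2 *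
    (∑ d ∈ Finset.Icc 1 ⌊y⌋₊, if (d : ℤ) ∣ ⌊α * n + β⌋ then w d else 0) ^ 2 with hF
  set T := (Finset.Icc 1 ⌊x⌋₊).filter fun n : ℕ =>
    y ^ 2 < n ∧ n.Prime ∧ Nat.Prime (⌊α * n + β⌋).toNat with hT
  have hsub : {p : ℕ | p.Prime ∧ (p : ℝ) ≤ x ∧ Nat.Prime (⌊α * p + β⌋).toNat} ⊆
      ((Finset.Icc 1 ⌊y ^ 2⌋₊ ∪ T : Finset ℕ) : Set ℕ) := by
    rintro p ⟨hp, hpx, hp'⟩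
    rw [Finset.coe_union, Set.mem_union, Finset.mem_coe, Finset.mem_coe]
    rcases le_or_gt (p : ℝ) (y ^ 2) with h | h
    · exact Or.inl (Finset.mem_Icc.mpr ⟨hp.one_le, Nat.le_floor h⟩)
    · exact Or.inr (Finset.mem_filter.mpr
        ⟨Finset.mem_Icc.mpr ⟨hp.one_le, Nat.le_floor hpx⟩, h, hp, hp'⟩)
  have hcard : (piStar α β x : ℝ) ≤ ((Finset.Icc 1 ⌊y ^ 2⌋₊ ∪ T).card : ℝ) := by
    have := Set.ncard_le_ncard hsub (Finset.finite_toSet _)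
    rw [Set.ncard_coe_finset] at this
    exact_mod_cast this
  have hone : ∀ n ∈ T, F n = 1 := by
    intro n hn
    obtain ⟨-, hyn, hp, hp'⟩ := Finset.mem_filter.mp hn
    have hDn : ⌊y⌋₊ < n := by
      have : ((⌊y⌋₊ : ℕ) : ℝ) < n := by nlinarith
      exact_mod_cast this
    have hz : ((⌊y⌋₊ : ℕ) : ℤ) + 1 ≤ ⌊α * n + β⌋ := by
      rw [Int.le_floor]
      push_cast
      nlinarith
    have hz' : ((⌊α * n + β⌋).toNat : ℤ) = ⌊α * n + β⌋ := Int.toNat_of_nonneg (by lia)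
    have h2 : (∑ d ∈ Finset.Icc 1 ⌊y⌋₊, if (d : ℤ) ∣ ⌊α * n + β⌋ then w d else 0) = w 1 := by
      rw [← sum_dvd_prime_eq hD hp' (by lia) w, ← hz']
      simp only [Int.natCast_dvd_natCast, Int.toNat_natCast]
    simp only [hF]
    rw [h2, sum_dvd_prime_eq hD hp hDn w, hw1]
    norm_num
  have hTE : (T.card : ℝ) ≤ E := by
    calc (T.card : ℝ) = ∑ n ∈ T, F n := by rw [Finset.sum_congr rfl hone]; simp
      _ ≤ ∑ n ∈ Finset.Icc 1 ⌊x⌋₊, F n :=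
        Finset.sum_le_sum_of_subset_of_nonneg (Finset.filter_subset _ _)
          fun n _ _ => mul_nonneg (sq_nonneg _) (sq_nonneg _)
      _ ≤ E := hE
  have hun : ((Finset.Icc 1 ⌊y ^ 2⌋₊ ∪ T).card : ℝ) ≤ (⌊y ^ 2⌋₊ : ℝ) + T.card := by
    have := Finset.card_union_le (Finset.Icc 1 ⌊y ^ 2⌋₊) T
    rw [Nat.card_Icc, Nat.add_sub_cancel] at this
    exact_mod_cast this
  have : (⌊y ^ 2⌋₊ : ℝ) ≤ y ^ 2 := Nat.floor_le (by positivity)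
  linarith

theorem piStar_le_of_notMem_nearRational {α β B x y : ℝ} (hy : 1 < y) (hx : x = y ^ 100)
    (hα0 : 0 < α) (hαB : α < B) (hα : α ∉ nearRational B y)
    (hlarge : y + 1 ≤ α * y ^ 2 + β) :
    (piStar α β x : ℝ) ≤ 110000 * x / (Real.log x) ^ 2 := by
  have hy0 : 0 < y := by linarith
  have hlog : 0 < Real.log y := Real.log_pos hy
  set D := ⌊y⌋₊ with hDdef
  have hD : 1 ≤ D := Nat.le_floor (by exact_mod_cast hy.le)
  have hDy : (D : ℝ) ≤ y := Nat.floor_le hy0.le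
  have hyD : y < D + 1 := Nat.lt_floor_add_one y
  obtain ⟨w, hw1, hwD, hQ0, hQ⟩ := exists_selberg_weights hD
  have hX : ((⌊x⌋₊ : ℕ) : ℝ) ≤ y ^ 100 := by
    rw [← hx]
    exact Nat.floor_le (by rw [hx]; positivity)
  have hequi : ∀ d ∈ Finset.Icc 1 (D ^ 2), ∀ e ∈ Finset.Icc 1 (D ^ 2),
      |(((Finset.Icc 1 ⌊x⌋₊).filter fun n : ℕ => d ∣ n ∧ (e : ℤ) ∣ ⌊α * n + β⌋).card : ℝ) -
        (⌊x⌋₊ : ℕ) * (1 / d * (1 / e))| ≤ 6 * y ^ 90 := by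
    intro d hd e he
    obtain ⟨a, q, hq, hcop, happ, hq1, hq2⟩ :=
      exists_approx_of_notMem_nearRational hy.le hα0 hαB hα hd he
    refine (abs_card_dvd_dvd_floor_sub_le (Finset.mem_Icc.mp hd).1 (Finset.mem_Icc.mp he).1
      hq hcop happ).trans ?_
    have h1 : ((⌊x⌋₊ : ℕ) : ℝ) / q ≤ y ^ 90 := by
      calc ((⌊x⌋₊ : ℕ) : ℝ) / q ≤ y ^ 100 / y ^ 10 := by gcongr
        _ = y ^ 90 := by field_simp
    have h2 : y ^ 50 ≤ y ^ 90 := pow_le_pow_right₀ hy.le (by norm_num)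
    have h3 : 1 ≤ y ^ 90 := one_le_pow₀ hy.le
    linarith
  have hsieve := sum_sq_mul_sq_le (fun n : ℕ => ⌊α * n + β⌋) w hwD hequi
  have hcount := piStar_le_of_equidistribution hy.le hα0 hlarge hw1 hsieve
  have hQ' : ∑ d ∈ Finset.Icc 1 D, ∑ e ∈ Finset.Icc 1 D, w d * w e / Nat.lcm d e ≤
      2 / Real.log y := hQ.trans (by gcongr)
  have hmain : ((⌊x⌋₊ : ℕ) : ℝ) *
      (∑ d ∈ Finset.Icc 1 D, ∑ e ∈ Finset.Icc 1 D, w d * w e / Nat.lcm d e) ^ 2 ≤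
        y ^ 100 * (2 / Real.log y) ^ 2 := by gcongr
  have herr : (D : ℝ) ^ 8 * (6 * y ^ 90) ≤ 6 * y ^ 98 := by
    calc (D : ℝ) ^ 8 * (6 * y ^ 90) ≤ y ^ 8 * (6 * y ^ 90) := by gcongr
      _ = 6 * y ^ 98 := by ring
  have h98 : y ^ 98 ≤ y ^ 100 / Real.log y ^ 2 := by
    rw [le_div_iff₀ (by positivity)]
    have : Real.log y ≤ y := (Real.log_le_sub_one_of_pos hy0).trans (by linarith)
    calc y ^ 98 * Real.log y ^ 2 ≤ y ^ 98 * y ^ 2 := by gcongr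
      _ = y ^ 100 := by ring
  have h2 : y ^ 2 ≤ y ^ 98 := pow_le_pow_right₀ hy.le (by norm_num)
  have hlogx : Real.log x = 100 * Real.log y := by
    rw [hx, Real.log_pow]
    norm_num
  have hfinal : 110000 * x / (Real.log x) ^ 2 = 11 * (y ^ 100 / Real.log y ^ 2) := by
    rw [hlogx, hx]
    field_simp
    norm_num
  have hmain' : y ^ 100 * (2 / Real.log y) ^ 2 = 4 * (y ^ 100 / Real.log y ^ 2) := by
    field_simp
    norm_num
  linarith

theorem piStar_upper_bound_ae :
    ∃ C c : ℝ, 0 < C ∧ 0 < c ∧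
      ∀ b₁ b₂ ε β : ℝ, 0 < b₁ → b₁ < b₂ → 0 < ε → ε < 1 / 12 →
        ∃ x₀ : ℝ, ∀ x : ℝ, x₀ ≤ x →
          ∃ J_E : Set ℝ, MeasurableSet J_E ∧ J_E ⊆ Set.Ioo b₁ b₂ ∧
            volume J_E ≤ ENNReal.ofReal (c * x ^ (-ε)) ∧
            ∀ α ∈ Set.Ioo b₁ b₂ \ J_E, Irrational α →
              (piStar α β x : ℝ) ≤ C * x / (Real.log x) ^ 2 := by
  refine ⟨110000, 1, by norm_num, one_pos, fun b₁ b₂ ε β hb₁ hb hε hε' => ?_⟩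
  have hb₂ : 0 < b₂ := hb₁.trans hb
  set y₀ := max (4 * b₂ + 10) ((2 + |β|) / b₁) with hy₀
  have hy₀pos : 0 < y₀ := lt_max_of_lt_left (by linarith)
  refine ⟨y₀ ^ 100, fun x hx => ?_⟩
  have hx0 : 0 < x := (pow_pos hy₀pos 100).trans_le hx
  obtain ⟨y, hy0, hyx⟩ : ∃ y : ℝ, 0 < y ∧ x = y ^ 100 := by
    refine ⟨x ^ ((100 : ℕ) : ℝ)⁻¹, by positivity, ?_⟩
    rw [Real.rpow_inv_natCast_pow hx0.le (by norm_num)]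
  have hyy : y₀ ≤ y := by
    rw [hyx] at hx
    exact le_of_pow_le_pow_left₀ (by norm_num) hy0.le hx
  have hy1 : 4 * b₂ + 10 ≤ y := (le_max_left _ _).trans hyy
  have hy2 : (2 + |β|) / b₁ ≤ y := (le_max_right _ _).trans hyy
  have hy : 1 < y := by linarith
  refine ⟨Set.Ioo b₁ b₂ ∩ nearRational b₂ y,
    measurableSet_Ioo.inter (measurableSet_nearRational b₂ y), Set.inter_subset_left, ?_, ?_⟩
  · refine (measure_mono Set.inter_subset_right).trans
      ((volume_nearRational_le hb₂.le hy.le).trans (ENNReal.ofReal_le_ofReal ?_))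
    have hpow : (y ^ 9)⁻¹ ≤ x ^ (-ε) := by
      rw [hyx, ← Real.rpow_natCast, ← Real.rpow_natCast, ← Real.rpow_neg hy0.le,
        ← Real.rpow_mul hy0.le]
      refine Real.rpow_le_rpow_of_exponent_le hy.le ?_
      push_cast
      linarith
    have h10 : (4 * b₂ + 10) * (y ^ 24)⁻¹ ≤ (y ^ 9)⁻¹ := by
      calc (4 * b₂ + 10) * (y ^ 24)⁻¹ ≤ y ^ 1 * (y ^ 24)⁻¹ := by rw [pow_one]; gcongr
        _ = (y ^ 23)⁻¹ := by field_simp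
        _ ≤ (y ^ 9)⁻¹ := by
          gcongr
          · exact hy.le
          · norm_num
    linarith
  · rintro α ⟨hα, hαJ⟩ -
    have hnot : α ∉ nearRational b₂ y := fun h => hαJ ⟨hα, h⟩
    refine piStar_le_of_notMem_nearRational hy hyx (hb₁.trans hα.1) hα.2 hnot ?_
    rw [div_le_iff₀ hb₁] at hy2
    have h1 : b₁ * y ^ 2 ≤ α * y ^ 2 := by
      have := hα.1.le
      gcongr
    have h2 : (2 + |β|) * y ≤ y * b₁ * y := by gcongr
    have h3 := neg_abs_le β
    have h4 : 0 ≤ |β| := abs_nonneg β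
    nlinarith
end

section
/- There is an absolute constant C > 0 such that for all coprime positive integers a and q, every real number β', every real y ≥ 1, and all reals 0 ≤ u < v ≤ 1, one has |#{1 ≤ n ≤ y : {a·n/q + β'} ∈ [u,v)} − y·(v−u)| ≤ C·(y/q + q·(v−u) + 1). -/
/-- A `q`-periodic predicate holds `k * count p q + count p r` times below `k * q + r`. -/
theorem count_mul_add_of_periodic (p : ℕ → Prop) [DecidablePred p] {q : ℕ}
    (hp : Function.Periodic p q) (k r : ℕ) :
    Nat.count p (k * q + r) = k * Nat.count p q + Nat.count p r := by
  induction k with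
  | zero => simp
  | succ k ih =>
    have hshift : (fun i => p (q + i)) = p := by
      funext i
      rw [add_comm]
      exact hp i
    have hcount : Nat.count (fun i => p (q + i)) (k * q + r) = Nat.count p (k * q + r) := by
      simp only [hshift]
    rw [show (k + 1) * q + r = q + (k * q + r) by ring, Nat.count_add, hcount, ih]
    ring

/-- Over a full period, an affine map with slope coprime to `q` hits each residue once. -/
theorem count_affine_emod_mem_Ico {a q : ℕ} (hq : 0 < q) (haq : Nat.Coprime a q) (b c d : ℤ)
    (hc : 0 ≤ c) (hd : d ≤ q) :
    Nat.count (fun n : ℕ => (a * n + b) % q ∈ Finset.Ico c d) q = (d - c).toNat := by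
  have hq' : (0 : ℤ) < q := by exact_mod_cast hq
  set f : ℕ → ℤ := fun n => (a * n + b) % q with hf
  have hmaps : Set.MapsTo f (Finset.range q) (Finset.Ico (0 : ℤ) q) := by
    intro n _
    simp only [Finset.coe_Ico, Set.mem_Ico, hf]
    exact ⟨Int.emod_nonneg _ hq'.ne', Int.emod_lt_of_pos _ hq'⟩
  have hinj : Set.InjOn f (Finset.range q) := by
    intro m hm n hn h
    have hmod : (a * m + b : ℤ) ≡ a * n + b [ZMOD q] := h
    have hmul : a * m ≡ a * n [MOD q] := by
      have := hmod.add_right_cancel' b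
      exact (Int.natCast_modEq_iff).1 (by exact_mod_cast this)
    have hmn : m ≡ n [MOD q] := Nat.ModEq.cancel_left_of_coprime haq.symm hmul
    exact hmn.eq_of_lt_of_lt (by simpa using hm) (by simpa using hn)
  have hsurj : Set.SurjOn f (Finset.range q) (Finset.Ico (0 : ℤ) q) :=
    Finset.surjOn_of_injOn_of_card_le f hmaps hinj (by simp)
  rw [Nat.count_eq_card_filter_range, ← Int.card_Ico]
  refine Finset.card_nbij f (fun n hn => (Finset.mem_filter.1 hn).2)
    (hinj.mono fun n hn => (Finset.mem_filter.1 hn).1) ?_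
  intro s hs
  have hs' := Finset.mem_Ico.1 hs
  obtain ⟨n, hn, rfl⟩ := hsurj (show s ∈ (Finset.Ico (0 : ℤ) q : Set ℤ) by simp; omega)
  exact ⟨n, Finset.mem_filter.2 ⟨hn, hs⟩, rfl⟩

theorem fract_intCast_div_add {q : ℕ} (hq : 0 < q) (z : ℤ) (β : ℝ) :
    Int.fract ((z : ℝ) / q + β) =
      (((z + ⌊(q : ℝ) * β⌋) % q : ℤ) + Int.fract ((q : ℝ) * β)) / q := by
  have hq' : (0 : ℝ) < q := by exact_mod_cast hq
  have hqz : (0 : ℤ) < q := by exact_mod_cast hq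
  set w := z + ⌊(q : ℝ) * β⌋ with hw
  have hθ := Int.fract_nonneg ((q : ℝ) * β)
  have hθ' := Int.fract_lt_one ((q : ℝ) * β)
  have h0 : (0 : ℝ) ≤ (w % q : ℤ) := by exact_mod_cast Int.emod_nonneg w hqz.ne'
  have h1 : ((w % q : ℤ) : ℝ) + 1 ≤ q := by exact_mod_cast Int.emod_lt_of_pos w hqz
  refine Int.fract_eq_iff.2 ⟨by positivity, by rw [div_lt_one hq']; linarith, w / q, ?_⟩
  have hdiv : ((w % q : ℤ) : ℝ) + q * (w / q : ℤ) = z + ⌊(q : ℝ) * β⌋ := by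
    exact_mod_cast (Int.emod_add_mul_ediv w q)
  have hfl := Int.floor_add_fract ((q : ℝ) * β)
  field_simp
  linarith

/-- The points of a coset of `q⁻¹ℤ` in `[u, v)` correspond to an interval of residues mod `q`. -/
theorem fract_intCast_div_add_mem_Ico_iff {q : ℕ} (hq : 0 < q) (z : ℤ) (β u v : ℝ) :
    Int.fract ((z : ℝ) / q + β) ∈ Set.Ico u v ↔
      (z + ⌊(q : ℝ) * β⌋) % q ∈ Finset.Ico ⌈q * u - Int.fract ((q : ℝ) * β)⌉
        ⌈q * v - Int.fract ((q : ℝ) * β)⌉ := by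
  have hq' : (0 : ℝ) < q := by exact_mod_cast hq
  rw [fract_intCast_div_add hq, Set.mem_Ico, Finset.mem_Ico, Int.ceil_le, Int.lt_ceil,
    le_div_iff₀ hq', div_lt_iff₀ hq', sub_le_iff_le_add, lt_sub_iff_add_lt, mul_comm u, mul_comm v]

theorem ncard_setOf_one_le_le_eq_count (p : ℕ → Prop) [DecidablePred p] {y : ℝ} (hy : 0 ≤ y) :
    {n : ℕ | 1 ≤ n ∧ (n : ℝ) ≤ y ∧ p n}.ncard = Nat.count (fun n => p (n + 1)) ⌊y⌋₊ := by
  have himage : {n : ℕ | 1 ≤ n ∧ (n : ℝ) ≤ y ∧ p n} =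
      (fun n => n + 1) '' ((Finset.range ⌊y⌋₊).filter fun n => p (n + 1) : Finset ℕ) := by
    ext n
    simp only [Set.mem_ofPred_eq, Set.mem_image, Finset.coe_filter, Finset.mem_range,
      ← Nat.le_floor_iff hy]
    constructor
    · rintro ⟨h1, h2, h3⟩
      exact ⟨n - 1, ⟨by omega, by rwa [Nat.sub_add_cancel h1]⟩, by omega⟩
    · rintro ⟨m, ⟨h1, h2⟩, rfl⟩
      exact ⟨by omega, by omega, h2⟩
  rw [himage, Set.ncard_image_of_injective _ (add_left_injective 1), Set.ncard_coe_finset,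
    Nat.count_eq_card_filter_range]

/-- A set of naturals of period `q` with nearly `q * δ` elements per period has nearly `y * δ`
elements up to `y`. -/
theorem abs_count_floor_sub_le_of_periodic (p : ℕ → Prop) [DecidablePred p] {q : ℕ} (hq : 0 < q)
    (hp : Function.Periodic p q) {δ y : ℝ} (hδ : 0 ≤ δ) (hy : 0 ≤ y)
    (hcount : |(Nat.count p q : ℝ) - q * δ| ≤ 1) :
    |(Nat.count p ⌊y⌋₊ : ℝ) - y * δ| ≤ y / q + q * δ + 1 := by
  have hq' : (0 : ℝ) < q := by exact_mod_cast hq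
  set N := ⌊y⌋₊ with hN
  have hdecomp := Nat.div_add_mod' N q
  have hr : N % q + 1 ≤ q := Nat.mod_lt N hq
  have hsum := count_mul_add_of_periodic p hp (N / q) (N % q)
  have hrem : Nat.count p (N % q) ≤ Nat.count p q := Nat.count_monotone p (by omega)
  rw [hdecomp] at hsum
  rw [hsum]
  generalize N / q = k at *
  generalize N % q = r at *
  generalize Nat.count p q = A at *
  generalize Nat.count p r = P at *
  have hNy : (N : ℝ) ≤ y := Nat.floor_le hy
  have hyN : y < N + 1 := Nat.lt_floor_add_one y
  have hdecomp' : (k : ℝ) * q + r = N := by exact_mod_cast hdecomp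
  have hr' : (r : ℝ) + 1 ≤ q := by exact_mod_cast hr
  have hr0 : (0 : ℝ) ≤ r := Nat.cast_nonneg r
  have hrem' : (P : ℝ) ≤ A := by exact_mod_cast hrem
  have hP0 : (0 : ℝ) ≤ P := Nat.cast_nonneg P
  have hk0 : (0 : ℝ) ≤ k := Nat.cast_nonneg k
  have hk : (k : ℝ) ≤ y / q := by
    rw [le_div_iff₀ hq']
    linarith
  obtain ⟨hlo, hhi⟩ := abs_le.1 hcount
  have hmain : |(k : ℝ) * (A - q * δ)| ≤ k := by
    rw [abs_mul, abs_of_nonneg hk0]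
    exact mul_le_of_le_one_right hk0 hcount
  obtain ⟨hmlo, hmhi⟩ := abs_le.1 hmain
  have ht0 : 0 ≤ (y - k * q) * δ := mul_nonneg (by linarith) hδ
  have htq : (y - k * q) * δ ≤ q * δ := mul_le_mul_of_nonneg_right (by linarith) hδ
  push_cast
  rw [abs_le]
  constructor <;> nlinarith

theorem equidistribution_rational_rotation :
    ∃ C : ℝ, 0 < C ∧
      ∀ a q : ℕ, 0 < a → 0 < q → Nat.Coprime a q →
        ∀ β' : ℝ, ∀ y : ℝ, 1 ≤ y → ∀ u v : ℝ, 0 ≤ u → u < v → v ≤ 1 →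
          |({n : ℕ | 1 ≤ n ∧ (n : ℝ) ≤ y ∧
                Int.fract ((a : ℝ) * n / q + β') ∈ Set.Ico u v}.ncard : ℝ) -
              y * (v - u)| ≤
            C * (y / q + q * (v - u) + 1) := by
  refine ⟨1, one_pos, fun a q _ hq haq β y hy u v hu huv hv => ?_⟩
  have hq' : (0 : ℝ) < q := by exact_mod_cast hq
  set θ := Int.fract ((q : ℝ) * β)
  set m := ⌊(q : ℝ) * β⌋
  set c := ⌈q * u - θ⌉
  set d := ⌈q * v - θ⌉
  have hθ0 : 0 ≤ θ := Int.fract_nonneg _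
  have hθ1 : θ < 1 := Int.fract_lt_one _
  have hquv : (q : ℝ) * u ≤ q * v := mul_le_mul_of_nonneg_left huv.le hq'.le
  have hc : 0 ≤ c := by
    have : (-1 : ℤ) < c := Int.lt_ceil.2 (by push_cast; nlinarith)
    omega
  have hd : d ≤ q := Int.ceil_le.2 (by push_cast; nlinarith)
  have hcd : c ≤ d := Int.ceil_mono (by linarith)
  have hset : {n : ℕ | 1 ≤ n ∧ (n : ℝ) ≤ y ∧ Int.fract ((a : ℝ) * n / q + β) ∈ Set.Ico u v} =
      {n : ℕ | 1 ≤ n ∧ (n : ℝ) ≤ y ∧ ((a : ℤ) * n + m) % q ∈ Finset.Ico c d} := by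
    ext n
    have := fract_intCast_div_add_mem_Ico_iff hq (a * n) β u v
    push_cast at this
    simp only [Set.mem_ofPred_eq, this, m, c, d, θ]
  have hfun : (fun n : ℕ => ((a : ℤ) * (n + 1 : ℕ) + m) % q ∈ Finset.Ico c d) =
      fun n : ℕ => ((a : ℤ) * n + (a + m)) % q ∈ Finset.Ico c d := by
    funext n
    push_cast
    ring_nf
  have hperiodic : Function.Periodic
      (fun n : ℕ => ((a : ℤ) * n + (a + m)) % q ∈ Finset.Ico c d) q := by
    intro n
    simp only
    rw [show (a : ℤ) * (n + q : ℕ) + (a + m) = a * n + (a + m) + a * q by push_cast; ring,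
      Int.add_mul_emod_self_right]
  rw [hset, ncard_setOf_one_le_le_eq_count _ (zero_le_one.trans hy), one_mul]
  simp only [hfun]
  refine abs_count_floor_sub_le_of_periodic _ hq hperiodic (sub_nonneg.2 huv.le)
    (zero_le_one.trans hy) ?_
  rw [count_affine_emod_mem_Ico hq haq _ c d hc hd]
  have hcast : (((d - c).toNat : ℕ) : ℝ) = d - c := by
    exact_mod_cast congrArg (Int.cast (R := ℝ)) (Int.toNat_of_nonneg (sub_nonneg.2 hcd))
  rw [hcast, abs_le]
  have hc1 := Int.le_ceil (q * u - θ)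
  have hc2 := Int.ceil_lt_add_one (q * u - θ)
  have hd1 := Int.le_ceil (q * v - θ)
  have hd2 := Int.ceil_lt_add_one (q * v - θ)
  constructor <;> linarith
end

section
/- Let a and q be coprime positive integers, let α', β' be real numbers, and let y ≥ 1 be real with |α' − a/q| ≤ 1/(q·y). Then for every real ρ with 2/q < ρ ≤ 1: #{1 ≤ n ≤ y : {a·n/q + β'} ∈ [1/q, ρ − 1/q)} ≤ #{1 ≤ n ≤ y : {α'·n + β'} ∈ [0, ρ)} ≤ #{1 ≤ n ≤ y : {a·n/q + β'} ∈ [0, ρ + 1/q) ∪ [1 − 1/q, 1)}. -/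
theorem finite_setOf_one_le_and_le_and (y : ℝ) (P : ℕ → Prop) :
    {n : ℕ | 1 ≤ n ∧ (n : ℝ) ≤ y ∧ P n}.Finite :=
  (Set.finite_Iic ⌊y⌋₊).subset fun _ hn => Nat.le_floor hn.2.1

theorem fract_mem_Ico_of_abs_sub_le {x z ε ρ : ℝ} (hxz : |z - x| ≤ ε) (hρ : ρ ≤ 1)
    (hx : Int.fract x ∈ Set.Ico ε (ρ - ε)) : Int.fract z ∈ Set.Ico 0 ρ := by
  obtain ⟨h₁, h₂⟩ := abs_le.1 hxz
  obtain ⟨h₃, h₄⟩ := hx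
  have hx' := Int.floor_add_fract x
  have hfloor : ⌊z⌋ = ⌊x⌋ := Int.floor_eq_iff.2 ⟨by linarith, by linarith⟩
  rw [Int.fract, hfloor]
  exact ⟨by linarith, by linarith⟩

theorem fract_mem_Ico_union_Ico_of_abs_sub_le {x z ε ρ : ℝ} (hxz : |z - x| ≤ ε) (hε : ε ≤ 1)
    (hz : Int.fract z ∈ Set.Ico 0 ρ) :
    Int.fract x ∈ Set.Ico 0 (ρ + ε) ∪ Set.Ico (1 - ε) 1 := by
  obtain ⟨h₁, h₂⟩ := abs_le.1 hxz
  obtain ⟨h₃, h₄⟩ := hz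
  have hz' := Int.floor_add_fract z
  have hx' := Int.floor_add_fract x
  have h₅ := Int.fract_nonneg x
  have h₆ := Int.fract_lt_one x
  rcases lt_or_ge x ⌊z⌋ with hlt | hge
  · have hfloor : ⌊x⌋ = ⌊z⌋ - 1 :=
      Int.floor_eq_iff.2 ⟨by push_cast; linarith, by push_cast; linarith⟩
    rw [hfloor] at hx'
    push_cast at hx'
    exact Or.inr ⟨by linarith, h₆⟩
  · have hfloor : (⌊z⌋ : ℝ) ≤ ⌊x⌋ := by exact_mod_cast Int.le_floor.2 hge
    exact Or.inl ⟨h₅, by linarith⟩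

theorem fract_sandwich_counts
    (a q : ℕ) (ha : 0 < a) (hq : 0 < q) (hcop : Nat.Coprime a q)
    (α' β' : ℝ) (y : ℝ) (hy : 1 ≤ y)
    (happrox : |α' - (a : ℝ) / q| ≤ 1 / (q * y)) :
    ∀ ρ : ℝ, 2 / q < ρ → ρ ≤ 1 →
      {n : ℕ | 1 ≤ n ∧ (n : ℝ) ≤ y ∧
          Int.fract ((a : ℝ) * n / q + β') ∈ Set.Ico (1 / (q : ℝ)) (ρ - 1 / q)}.ncard ≤
        {n : ℕ | 1 ≤ n ∧ (n : ℝ) ≤ y ∧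
            Int.fract (α' * n + β') ∈ Set.Ico (0 : ℝ) ρ}.ncard ∧
      {n : ℕ | 1 ≤ n ∧ (n : ℝ) ≤ y ∧
          Int.fract (α' * n + β') ∈ Set.Ico (0 : ℝ) ρ}.ncard ≤
        {n : ℕ | 1 ≤ n ∧ (n : ℝ) ≤ y ∧
            Int.fract ((a : ℝ) * n / q + β') ∈
              Set.Ico (0 : ℝ) (ρ + 1 / q) ∪ Set.Ico (1 - 1 / (q : ℝ)) 1}.ncard := by
  intro ρ _ hρ
  have hq' : (0 : ℝ) < q := by exact_mod_cast hq
  have hε : 1 / (q : ℝ) ≤ 1 := by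
    rw [div_le_one hq']
    exact_mod_cast hq
  have hclose (n : ℕ) (hn : (n : ℝ) ≤ y) :
      |(α' * n + β') - ((a : ℝ) * n / q + β')| ≤ 1 / q := by
    have hy' : 0 < y := by linarith
    calc |(α' * n + β') - ((a : ℝ) * n / q + β')| = |α' - (a : ℝ) / q| * n := by
          rw [← abs_of_nonneg (Nat.cast_nonneg n : (0 : ℝ) ≤ n), ← abs_mul,
            abs_of_nonneg (Nat.cast_nonneg n : (0 : ℝ) ≤ n)]
          congr 1
          ring
      _ ≤ 1 / (q * y) * y := by gcongr
      _ = 1 / q := by field_simp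
  refine ⟨Set.ncard_le_ncard ?_ (finite_setOf_one_le_and_le_and y _),
    Set.ncard_le_ncard ?_ (finite_setOf_one_le_and_le_and y _)⟩
  · rintro n ⟨h₁, hn, h⟩
    exact ⟨h₁, hn, fract_mem_Ico_of_abs_sub_le (hclose n hn) hρ h⟩
  · rintro n ⟨h₁, hn, h⟩
    exact ⟨h₁, hn, fract_mem_Ico_union_Ico_of_abs_sub_le (hclose n hn) hε h⟩
end

section
/- There is an absolute constant c > 0 such that for every real z ≥ 3, Σ_{m < z, m squarefree} ∏_{p∣m} (2/p − 1/p²) ≥ c·(log z)², where the sum runs over squarefree positive integers m < z and the product runs over the prime divisors p of m (with the empty product for m = 1 equal to 1). -/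
/-- A sum is bounded by another one over a set that receives its index set injectively. -/
theorem sum_le_sum_of_injOn_of_le {α β : Type*} [DecidableEq β] {s : Finset α} {t : Finset β}
    {f : α → ℝ} {g : β → ℝ} (i : α → β) (hi : ∀ a ∈ s, i a ∈ t)
    (hinj : Set.InjOn i s) (hg : ∀ b ∈ t, 0 ≤ g b) (hfg : ∀ a ∈ s, f a ≤ g (i a)) :
    ∑ a ∈ s, f a ≤ ∑ b ∈ t, g b := by
  calc ∑ a ∈ s, f a ≤ ∑ a ∈ s, g (i a) := Finset.sum_le_sum hfg
    _ = ∑ b ∈ s.image i, g b := (Finset.sum_image hinj).symm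
    _ ≤ ∑ b ∈ t, g b := Finset.sum_le_sum_of_subset_of_nonneg
        (Finset.image_subset_iff.2 hi) fun b hb _ => hg b hb

theorem sum_Icc_one_div_sq_le_two (N : ℕ) : ∑ k ∈ Finset.Icc 1 N, 1 / (k : ℝ) ^ 2 ≤ 2 := by
  have h := sum_Ioo_inv_sq_le (α := ℝ) 0 (N + 1)
  have e : Finset.Ioo 0 (N + 1) = Finset.Icc 1 N := by ext; simp; omega
  rw [e] at h
  simpa [one_div] using h

/-- The squarefree integers up to `N`. -/
def squarefreeUpTo (N : ℕ) : Finset ℕ := (Finset.range (N + 1)).filter Squarefree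

theorem mem_squarefreeUpTo {N m : ℕ} : m ∈ squarefreeUpTo N ↔ m ≤ N ∧ Squarefree m := by
  simp [squarefreeUpTo]

theorem log_succ_le_two_mul_sum_squarefree (N : ℕ) :
    Real.log (N + 1) ≤ 2 * ∑ s ∈ squarefreeUpTo N, 1 / (s : ℝ) := by
  have hlog : Real.log (N + 1) ≤ ∑ n ∈ Finset.Icc 1 N, 1 / (n : ℝ) := by
    have h := log_add_one_le_harmonic N
    rw [harmonic_eq_sum_Icc] at h
    push_cast at h
    simpa [one_div] using h
  choose s k hsk using Nat.sq_mul_squarefree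
  have hle : ∑ n ∈ Finset.Icc 1 N, 1 / (n : ℝ) ≤
      ∑ x ∈ Finset.Icc 1 N ×ˢ squarefreeUpTo N, 1 / (x.1 : ℝ) ^ 2 * (1 / (x.2 : ℝ)) := by
    refine sum_le_sum_of_injOn_of_le (fun n => (k n, s n)) ?_ ?_ ?_ ?_
    · intro n hn
      obtain ⟨h1, h2⟩ := Finset.mem_Icc.1 hn
      obtain ⟨he, hs⟩ := hsk n
      have hk : 0 < k n := by
        rcases Nat.eq_zero_or_pos (k n) with h | h
        · rw [h] at he; simp at he; omega
        · exact h
      simp only [Finset.mem_product, Finset.mem_Icc, mem_squarefreeUpTo]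
      have hk1 : k n ≤ n := (Nat.le_self_pow two_ne_zero _).trans
        (Nat.le_of_dvd h1 (Dvd.intro _ he))
      have hs1 : s n ≤ n := Nat.le_of_dvd h1 (Dvd.intro_left _ he)
      exact ⟨⟨hk, hk1.trans h2⟩, hs1.trans h2, hs⟩
    · intro a _ b _ h
      simp only [Prod.mk.injEq] at h
      rw [← (hsk a).1, ← (hsk b).1, h.1, h.2]
    · intro x _; positivity
    · intro n _
      conv_lhs => rw [← (hsk n).1]
      push_cast
      rw [one_div_mul_one_div]
  rw [Finset.sum_product] at hle
  dsimp only at hle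
  rw [← Finset.sum_mul_sum] at hle
  exact hlog.trans (hle.trans (mul_le_mul_of_nonneg_right (sum_Icc_one_div_sq_le_two N)
    (Finset.sum_nonneg fun _ _ => by positivity)))

theorem sq_sum_squarefree_le (N : ℕ) :
    (∑ s ∈ squarefreeUpTo N, 1 / (s : ℝ)) ^ 2 ≤
      2 * ∑ m ∈ squarefreeUpTo (N ^ 2), ∏ p ∈ m.primeFactors, (2 / (p : ℝ)) := by
  have hdiv : ∀ m ∈ squarefreeUpTo (N ^ 2), ∏ p ∈ m.primeFactors, (2 / (p : ℝ)) =
      ∑ _T ∈ m.primeFactors.powerset, 1 / (m : ℝ) := by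
    intro m hm
    have hm' := Nat.prod_primeFactors_of_squarefree (mem_squarefreeUpTo.1 hm).2
    rw [Finset.prod_div_distrib, ← Nat.cast_prod, hm']
    simp [div_eq_mul_inv]
  rw [Finset.sum_congr rfl hdiv, Finset.sum_sigma', sq, Finset.sum_mul_sum,
    ← Finset.sum_product']
  refine le_trans ?_ (mul_le_mul_of_nonneg_right (sum_Icc_one_div_sq_le_two N)
    (Finset.sum_nonneg fun _ _ => by positivity))
  rw [Finset.sum_mul_sum, ← Finset.sum_product']
  refine sum_le_sum_of_injOn_of_le (fun x => (x.1.gcd x.2,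
    ⟨(x.1 / x.1.gcd x.2) * (x.2 / x.1.gcd x.2), (x.1 / x.1.gcd x.2).primeFactors⟩)) ?_ ?_ ?_ ?_
  · rintro ⟨s, t⟩ h
    simp only [Finset.mem_product, mem_squarefreeUpTo, Finset.mem_sigma, Finset.mem_Icc,
      Finset.mem_powerset] at h ⊢
    obtain ⟨⟨hsN, hs⟩, htN, ht⟩ := h
    have hs0 := Nat.pos_of_ne_zero hs.ne_zero
    have hd : 0 < s.gcd t := Nat.gcd_pos_of_pos_left _ hs0
    have hs' := hs.squarefree_of_dvd (Nat.div_dvd_of_dvd (Nat.gcd_dvd_left s t))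
    have ht' := ht.squarefree_of_dvd (Nat.div_dvd_of_dvd (Nat.gcd_dvd_right s t))
    refine ⟨⟨hd, (Nat.gcd_le_left _ hs0).trans hsN⟩, ⟨?_, ?_⟩, ?_⟩
    · rw [sq]
      exact Nat.mul_le_mul ((Nat.div_le_self _ _).trans hsN) ((Nat.div_le_self _ _).trans htN)
    · exact (Nat.squarefree_mul (Nat.coprime_div_gcd_div_gcd hd)).2 ⟨hs', ht'⟩
    · exact Nat.primeFactors_mono (dvd_mul_right _ _) (mul_ne_zero hs'.ne_zero ht'.ne_zero)
  · rintro ⟨s, t⟩ h ⟨s', t'⟩ h' e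
    simp only [Finset.coe_product, Set.mem_prod, Finset.mem_coe, mem_squarefreeUpTo] at h h'
    simp only [Prod.mk.injEq, Sigma.mk.injEq, heq_eq_eq] at e
    obtain ⟨hd, hm, hT⟩ := e
    have hs' := h.1.2.squarefree_of_dvd (Nat.div_dvd_of_dvd (Nat.gcd_dvd_left s t))
    have hs'' := h'.1.2.squarefree_of_dvd (Nat.div_dvd_of_dvd (Nat.gcd_dvd_left s' t'))
    have hq : s / s.gcd t = s' / s'.gcd t' := by
      rw [← Nat.prod_primeFactors_of_squarefree hs', hT,
        Nat.prod_primeFactors_of_squarefree hs'']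
    have hr : t / s.gcd t = t' / s'.gcd t' := by
      rw [hq] at hm
      exact Nat.eq_of_mul_eq_mul_left (Nat.pos_of_ne_zero hs''.ne_zero) hm
    rw [Prod.mk.injEq]
    constructor
    · rw [← Nat.div_mul_cancel (Nat.gcd_dvd_left s t), hq, hd,
        Nat.div_mul_cancel (Nat.gcd_dvd_left s' t')]
    · rw [← Nat.div_mul_cancel (Nat.gcd_dvd_right s t), hr, hd,
        Nat.div_mul_cancel (Nat.gcd_dvd_right s' t')]
  · intro x _; positivity
  · rintro ⟨s, t⟩ -
    have hs : (s : ℝ) = ((s / s.gcd t : ℕ) : ℝ) * (s.gcd t : ℝ) := by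
      rw [← Nat.cast_mul, Nat.div_mul_cancel (Nat.gcd_dvd_left s t)]
    have ht : (t : ℝ) = ((t / s.gcd t : ℕ) : ℝ) * (s.gcd t : ℝ) := by
      rw [← Nat.cast_mul, Nat.div_mul_cancel (Nat.gcd_dvd_right s t)]
    simp only [one_div_mul_one_div]
    refine le_of_eq (congrArg _ ?_)
    rw [Nat.cast_mul]
    conv_lhs => rw [hs, ht]
    ring

theorem prod_primeFactors_two_div_sub_nonneg (m : ℕ) :
    0 ≤ ∏ p ∈ m.primeFactors, (2 / (p : ℝ) - 1 / (p : ℝ) ^ 2) := by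
  refine Finset.prod_nonneg fun p hp => ?_
  have hp1 : (1 : ℝ) ≤ p := by exact_mod_cast (Nat.prime_of_mem_primeFactors hp).one_le
  have hp2 : 2 / (p : ℝ) - 1 / (p : ℝ) ^ 2 = (2 * p - 1) / (p : ℝ) ^ 2 := by field_simp
  rw [hp2]
  exact div_nonneg (by linarith) (by positivity)

theorem sum_squarefree_prod_two_div_le (M : ℕ) :
    ∑ m ∈ squarefreeUpTo M, ∏ p ∈ m.primeFactors, (2 / (p : ℝ)) ≤
      2 * ∑ m ∈ squarefreeUpTo M, ∏ p ∈ m.primeFactors, (2 / (p : ℝ) - 1 / (p : ℝ) ^ 2) := by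
  have hexp : ∀ m : ℕ, ∏ p ∈ m.primeFactors, (2 / (p : ℝ)) =
      ∑ T ∈ m.primeFactors.powerset, (∏ p ∈ T, 1 / (p : ℝ) ^ 2) *
        ∏ p ∈ m.primeFactors \ T, (2 / (p : ℝ) - 1 / (p : ℝ) ^ 2) := by
    intro m
    rw [← Finset.prod_add]
    exact Finset.prod_congr rfl fun p _ => by ring
  simp_rw [hexp]
  rw [Finset.sum_sigma']
  refine le_trans ?_ (mul_le_mul_of_nonneg_right (sum_Icc_one_div_sq_le_two M)
    (Finset.sum_nonneg fun m _ => prod_primeFactors_two_div_sub_nonneg m))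
  rw [Finset.sum_mul_sum, ← Finset.sum_product']
  have hprime : ∀ {m : ℕ} {T : Finset ℕ}, T ⊆ m.primeFactors → ∀ p ∈ T, p.Prime :=
    fun hT p hp => Nat.prime_of_mem_primeFactors (hT hp)
  have hmul : ∀ {m : ℕ} {T : Finset ℕ}, Squarefree m → T ⊆ m.primeFactors →
      (∏ p ∈ T, p) * ∏ p ∈ m.primeFactors \ T, p = m := by
    intro m T hm hT
    rw [mul_comm, Finset.prod_sdiff hT, Nat.prod_primeFactors_of_squarefree hm]
  refine sum_le_sum_of_injOn_of_le
    (fun x => (∏ p ∈ x.2, p, ∏ p ∈ x.1.primeFactors \ x.2, p)) ?_ ?_ ?_ ?_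
  · rintro ⟨m, T⟩ h
    simp only [Finset.mem_product, mem_squarefreeUpTo, Finset.mem_sigma, Finset.mem_Icc,
      Finset.mem_powerset] at h ⊢
    obtain ⟨⟨hmM, hm⟩, hT⟩ := h
    have he := hmul hm hT
    have hm0 := Nat.pos_of_ne_zero hm.ne_zero
    have hv : ∏ p ∈ m.primeFactors \ T, p ∣ m := Dvd.intro_left _ he
    have hu : ∏ p ∈ T, p ∣ m := Dvd.intro _ he
    exact ⟨⟨Nat.pos_of_dvd_of_pos hu hm0, (Nat.le_of_dvd hm0 hu).trans hmM⟩,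
      (Nat.le_of_dvd hm0 hv).trans hmM, hm.squarefree_of_dvd hv⟩
  · rintro ⟨m, T⟩ h ⟨m', T'⟩ h' e
    simp only [Finset.coe_sigma, Set.mem_sigma_iff, Finset.mem_coe, mem_squarefreeUpTo,
      Finset.mem_powerset] at h h'
    simp only [Prod.mk.injEq] at e
    have hm : m = m' := by rw [← hmul h.1.2 h.2, ← hmul h'.1.2 h'.2, e.1, e.2]
    have hT : T = T' := by
      rw [← Nat.primeFactors_prod (hprime h.2), ← Nat.primeFactors_prod (hprime h'.2), e.1]
    rw [hm, hT]
  · intro x _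
    exact mul_nonneg (by positivity) (prod_primeFactors_two_div_sub_nonneg _)
  · rintro ⟨m, T⟩ h
    have hT : m.primeFactors \ T ⊆ m.primeFactors := Finset.sdiff_subset
    simp only
    rw [Nat.primeFactors_prod (hprime hT)]
    simp [Finset.prod_pow]

theorem selberg_sum_lower_bound :
    ∃ c : ℝ, 0 < c ∧
      ∀ z : ℝ, 3 ≤ z →
        c * (Real.log z) ^ 2 ≤
          ∑ m ∈ (Finset.range ⌈z⌉₊).filter Squarefree,
            ∏ p ∈ m.primeFactors, (2 / (p : ℝ) - 1 / (p : ℝ) ^ 2) := by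
  refine ⟨1 / 64, by norm_num, fun z hz => ?_⟩
  have hz0 : (0 : ℝ) ≤ z := by linarith
  obtain ⟨N, hN⟩ : ∃ N, ⌈√z⌉₊ = N + 1 :=
    Nat.exists_eq_succ_of_ne_zero (Nat.ceil_pos.2 (Real.sqrt_pos.2 (by linarith))).ne'
  have hle : √z ≤ N + 1 := by exact_mod_cast hN ▸ Nat.le_ceil √z
  have hlt : (N : ℝ) < √z := Nat.lt_ceil.1 (by omega)
  have hNz : ((N ^ 2 : ℕ) : ℝ) < z := by
    push_cast
    exact (Real.lt_sqrt N.cast_nonneg).1 hlt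
  have hset : squarefreeUpTo (N ^ 2) ⊆ (Finset.range ⌈z⌉₊).filter Squarefree := by
    refine Finset.filter_subset_filter _ (Finset.range_subset_range.2 ?_)
    exact Nat.succ_le_of_lt (Nat.lt_ceil.2 hNz)
  have hS := Finset.sum_le_sum_of_subset_of_nonneg hset
    fun m _ _ => prod_primeFactors_two_div_sub_nonneg m
  have hlog : Real.log z / 2 ≤ Real.log (N + 1) := by
    rw [← Real.log_sqrt hz0]
    exact Real.log_le_log (Real.sqrt_pos.2 (by linarith)) hle
  have hQ := hlog.trans (log_succ_le_two_mul_sum_squarefree N)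
  have hz1 : 0 ≤ Real.log z := Real.log_nonneg (by linarith)
  have hsq := pow_le_pow_left₀ (by positivity) hQ 2
  have h1 := sq_sum_squarefree_le N
  have h2 := sum_squarefree_prod_two_div_le (N ^ 2)
  rw [mul_pow] at hsq
  linarith
end

section
/- Let 0 < c₁ < c₂ and let β be a real number. There exist a constant C > 0 and x₀ (both depending only on c₁, c₂, β) such that for every real x ≥ x₀, ∫_{c₁}^{c₂} π*_{α,β}(x) dα ≥ (c₂ − c₁)·(x/(log x)²)·(1 − C/log x). -/
open MeasureTheory

/-- The `n`-th term of the telescoped series for `(s - 1) ζ(s) - 1`. -/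
noncomputable def zetaTerm (n : ℕ) (s : ℂ) : ℂ :=
  (s - 1) * ((n + 1 : ℕ) : ℂ) ^ (-s) +
    (((n + 2 : ℕ) : ℂ) ^ (1 - s) - ((n + 1 : ℕ) : ℂ) ^ (1 - s))

lemma differentiable_zetaTerm (n : ℕ) : Differentiable ℂ (zetaTerm n) := by
  have h1 : ((n + 1 : ℕ) : ℂ) ≠ 0 := by exact_mod_cast Nat.succ_ne_zero n
  have h2 : ((n + 2 : ℕ) : ℂ) ≠ 0 := by exact_mod_cast Nat.succ_ne_zero (n + 1)
  intro s
  unfold zetaTerm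
  refine DifferentiableAt.add (DifferentiableAt.mul (by fun_prop) ?_) (DifferentiableAt.sub ?_ ?_)
  · exact DifferentiableAt.const_cpow (by fun_prop) (Or.inl h1)
  · exact DifferentiableAt.const_cpow (by fun_prop) (Or.inl h2)
  · exact DifferentiableAt.const_cpow (by fun_prop) (Or.inl h1)

lemma norm_cpow_neg_sub_le {a u : ℝ} (ha : 1 ≤ a) (hu : u ∈ Set.Icc a (a + 1)) {s : ℂ}
    (hs : 0 < s.re) :
    ‖(a : ℂ) ^ (-s) - (u : ℂ) ^ (-s)‖ ≤ 2 * a ^ (-s.re) ∧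
    ‖(a : ℂ) ^ (-s) - (u : ℂ) ^ (-s)‖ ≤ ‖s‖ * a ^ (-s.re - 1) := by
  have ha0 : 0 < a := by linarith
  have hu0 : 0 < u := by linarith [hu.1]
  constructor
  · refine (norm_sub_le _ _).trans ?_
    rw [Complex.norm_cpow_eq_rpow_re_of_pos ha0, Complex.norm_cpow_eq_rpow_re_of_pos hu0]
    have : u ^ (-s).re ≤ a ^ (-s).re :=
      Real.rpow_le_rpow_of_nonpos ha0 hu.1 (by simp [hs.le])
    simp only [Complex.neg_re] at *
    linarith
  · have hs0 : s ≠ 0 := by rintro rfl; simp at hs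
    have key := (convex_Icc a (a + 1)).norm_image_sub_le_of_norm_hasDerivWithin_le
      (f := fun v : ℝ => (v : ℂ) ^ (-s)) (f' := fun v : ℝ => (-s) * (v : ℂ) ^ (-s - 1))
      (C := ‖s‖ * a ^ (-s.re - 1)) (x := u) (y := a) ?_ ?_ hu ⟨le_rfl, by linarith⟩
    · refine key.trans ?_
      have : ‖a - u‖ ≤ 1 := by
        rw [Real.norm_eq_abs, abs_le]; constructor <;> linarith [hu.1, hu.2]
      calc _ ≤ ‖s‖ * a ^ (-s.re - 1) * 1 := by gcongr
        _ = _ := mul_one _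
    · intro v hv
      have hv0 : v ≠ 0 := by linarith [hv.1]
      have hv' : (v : ℂ) ∈ Complex.slitPlane := by simp [Complex.mem_slitPlane_iff]; linarith [hv.1]
      have := (hasDerivAt_id (v : ℂ)).cpow_const (c := -s) hv'
      simpa using (this.comp_ofReal).hasDerivWithinAt
    · intro v hv
      have hv0 : 0 < v := by linarith [hv.1]
      rw [norm_mul, norm_neg, Complex.norm_cpow_eq_rpow_re_of_pos hv0]
      gcongr
      simp only [Complex.sub_re, Complex.neg_re, Complex.one_re]
      exact Real.rpow_le_rpow_of_nonpos ha0 hv.1 (by linarith)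

lemma norm_zetaTerm_le {ε : ℝ} (hε : 0 < ε) (hε1 : ε < 1) (n : ℕ) {s : ℂ}
    (hs : 1 - ε / 2 ≤ s.re) :
    ‖zetaTerm n s‖ ≤ ‖s - 1‖ * (2 * ‖s‖ ^ ε * ((n + 1 : ℕ) : ℝ) ^ (-(1 + ε / 2))) := by
  by_cases h1 : s = 1
  · subst h1; simp [zetaTerm]
  have hs0 : 0 < s.re := by linarith
  set a : ℝ := ((n + 1 : ℕ) : ℝ) with ha
  have ha1 : 1 ≤ a := by rw [ha]; exact_mod_cast Nat.succ_le_succ (Nat.zero_le n)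
  have ha0 : 0 < a := by linarith
  have h_int : ∫ u in a..(a + 1), (u : ℂ) ^ (-s) =
      (((a + 1 : ℝ) : ℂ) ^ (-s + 1) - (a : ℂ) ^ (-s + 1)) / (-s + 1) := by
    apply integral_cpow
    right
    refine ⟨fun h => h1 (by simpa using h), ?_⟩
    rw [Set.uIcc_of_le (by linarith)]
    intro h; linarith [h.1]
  have hII : IntervalIntegrable (fun u : ℝ => (u : ℂ) ^ (-s)) volume a (a + 1) := by
    apply intervalIntegral.intervalIntegrable_cpow
    right
    rw [Set.uIcc_of_le (by linarith)]
    intro h; linarith [h.1]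
  have heq : zetaTerm n s = (s - 1) * ∫ u in a..(a + 1), ((a : ℂ) ^ (-s) - (u : ℂ) ^ (-s)) := by
    rw [intervalIntegral.integral_sub (by simp) hII, h_int]
    have h2 : -s + 1 ≠ 0 := fun h => h1 (by linear_combination -h)
    have ha' : (a : ℂ) = ((n + 1 : ℕ) : ℂ) := by simp [ha]
    have ha'' : ((a + 1 : ℝ) : ℂ) = ((n + 2 : ℕ) : ℂ) := by simp [ha]; ring
    rw [ha', ha'']
    simp only [zetaTerm, intervalIntegral.integral_const, add_sub_cancel_left, one_smul]
    rw [show (1 - s : ℂ) = -s + 1 by ring]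
    field_simp
    ring
  rw [heq, norm_mul]
  gcongr
  have := intervalIntegral.norm_integral_le_of_norm_le_const (a := a) (b := a + 1)
    (f := fun u : ℝ => (a : ℂ) ^ (-s) - (u : ℂ) ^ (-s))
    (C := 2 * ‖s‖ ^ ε * a ^ (-(1 + ε / 2))) ?_
  · simpa using this
  intro u hu
  rw [Set.uIoc_of_le (by linarith)] at hu
  obtain ⟨hA, hB⟩ := norm_cpow_neg_sub_le ha1 ⟨hu.1.le, hu.2⟩ hs0
  set D := ‖(a : ℂ) ^ (-s) - (u : ℂ) ^ (-s)‖ with hD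
  have hD0 : 0 ≤ D := norm_nonneg _
  calc D = D ^ (1 - ε) * D ^ ε := by
        rw [← Real.rpow_add' hD0 (by norm_num)]; simp
    _ ≤ (2 * a ^ (-s.re)) ^ (1 - ε) * (‖s‖ * a ^ (-s.re - 1)) ^ ε := by
        have : 0 ≤ 1 - ε := by linarith
        gcongr
    _ = 2 ^ (1 - ε) * ‖s‖ ^ ε * a ^ (-s.re - ε) := by
        rw [Real.mul_rpow (by positivity) (by positivity),
          Real.mul_rpow (by positivity) (by positivity), ← Real.rpow_mul ha0.le,
          ← Real.rpow_mul ha0.le]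
        rw [show -s.re - ε = -s.re * (1 - ε) + (-s.re - 1) * ε by ring, Real.rpow_add ha0]
        ring
    _ ≤ 2 * ‖s‖ ^ ε * a ^ (-(1 + ε / 2)) := by
        gcongr
        · calc (2 : ℝ) ^ (1 - ε) ≤ 2 ^ (1 : ℝ) :=
              Real.rpow_le_rpow_of_exponent_le (by norm_num) (by linarith)
            _ = 2 := by norm_num
        · linarith

lemma summable_succ_rpow_neg {r : ℝ} (hr : 1 < r) :
    Summable fun n : ℕ => ((n + 1 : ℕ) : ℝ) ^ (-r) :=
  (summable_nat_add_iff 1).2 (Real.summable_nat_rpow.2 (by linarith))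

lemma hasSum_zetaTerm_of_one_lt {s : ℂ} (hs : 1 < s.re) :
    HasSum (fun n => zetaTerm n s) ((s - 1) * riemannZeta s - 1) := by
  have hsum : Summable fun n => zetaTerm n s := by
    refine Summable.of_norm_bounded (g := fun n : ℕ => ‖s - 1‖ * (2 * ‖s‖ ^ (1 / 2 : ℝ) *
      ((n + 1 : ℕ) : ℝ) ^ (-(1 + (1 / 2 : ℝ) / 2)))) ?_ fun n =>
        norm_zetaTerm_le (by norm_num) (by norm_num) n (by linarith)
    exact ((summable_succ_rpow_neg (by norm_num)).mul_left _).mul_left _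
  rw [hsum.hasSum_iff_tendsto_nat]
  have hz : Filter.Tendsto (fun N : ℕ => ∑ n ∈ Finset.range N, ((n + 1 : ℕ) : ℂ) ^ (-s))
      Filter.atTop (nhds (riemannZeta s)) := by
    rw [zeta_eq_tsum_one_div_nat_add_one_cpow hs]
    have h1 := (Complex.summable_one_div_nat_cpow (p := s)).2 hs
    have h2 := (summable_nat_add_iff 1).2 h1
    have := h2.hasSum.tendsto_sum_nat
    simp only [Nat.cast_add, Nat.cast_one] at this
    refine this.congr fun N => Finset.sum_congr rfl fun n _ => ?_
    rw [Complex.cpow_neg, one_div, Nat.cast_add, Nat.cast_one]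
  have hp : Filter.Tendsto (fun N : ℕ => ((N + 1 : ℕ) : ℂ) ^ (1 - s)) Filter.atTop (nhds 0) := by
    rw [tendsto_zero_iff_norm_tendsto_zero]
    have h3 : Filter.Tendsto (fun N : ℕ => ((N + 1 : ℕ) : ℝ) ^ (-(s.re - 1)))
        Filter.atTop (nhds 0) :=
      (tendsto_rpow_neg_atTop (by linarith)).comp
        (tendsto_natCast_atTop_atTop.comp (Filter.tendsto_add_atTop_nat 1))
    refine h3.congr fun N => ?_
    rw [Complex.norm_natCast_cpow_of_pos (Nat.succ_pos N)]
    congr 1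
    simp
  have hN : ∀ N : ℕ, ∑ n ∈ Finset.range N, zetaTerm n s =
      (s - 1) * ∑ n ∈ Finset.range N, ((n + 1 : ℕ) : ℂ) ^ (-s) +
        (((N + 1 : ℕ) : ℂ) ^ (1 - s) - 1) := by
    intro N
    simp only [zetaTerm, Finset.sum_add_distrib, ← Finset.mul_sum]
    congr 1
    have := Finset.sum_range_sub (fun n : ℕ => ((n + 1 : ℕ) : ℂ) ^ (1 - s)) N
    rw [Finset.sum_sub_distrib] at this ⊢
    simpa [add_assoc, one_add_one_eq_two] using this
  simp_rw [hN]
  simpa [sub_eq_add_neg] using (hz.const_mul (s - 1)).add (hp.sub_const 1)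

lemma riemannZeta₁_eq_tsum {ε : ℝ} (hε : 0 < ε) (hε1 : ε < 1) {s : ℂ} (hs : 1 - ε / 2 < s.re) :
    riemannZeta₁ s = 1 + ∑' n, zetaTerm n s := by
  set R : ℝ := ‖s‖ + 3 with hR
  set U : Set ℂ := {z : ℂ | 1 - ε / 2 < z.re} ∩ Metric.ball 0 R with hU
  have hUo : IsOpen U := (isOpen_lt continuous_const Complex.continuous_re).inter Metric.isOpen_ball
  have hUc : Convex ℝ U := (convex_halfSpace_re_gt _).inter (convex_ball _ _)
  have hd : DifferentiableOn ℂ (fun z => 1 + ∑' n, zetaTerm n z) U := by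
    refine (differentiableOn_const 1).add ?_
    refine Complex.differentiableOn_tsum_of_summable_norm
      (u := fun n : ℕ => (R + 1) * (2 * R ^ ε * ((n + 1 : ℕ) : ℝ) ^ (-(1 + ε / 2)))) ?_
      (fun n => (differentiable_zetaTerm n).differentiableOn) hUo ?_
    · exact ((summable_succ_rpow_neg (by linarith)).mul_left _).mul_left _
    · intro n z hz
      refine (norm_zetaTerm_le hε hε1 n hz.1.le).trans ?_
      have hz2 : ‖z‖ ≤ R := by simpa using (Metric.mem_ball.1 hz.2).le
      have : ‖z - 1‖ ≤ R + 1 := (norm_sub_le _ _).trans (by simpa using hz2)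
      gcongr
  have h2 : (2 : ℂ) ∈ U := by
    refine ⟨by simp; linarith, ?_⟩
    simp only [Metric.mem_ball, dist_zero_right, hR]
    have := norm_nonneg s
    simp; linarith
  refine AnalyticOnNhd.eqOn_of_preconnected_of_eventuallyEq (z₀ := 2)
    (differentiable_riemannZeta₁.differentiableOn.analyticOnNhd hUo) (hd.analyticOnNhd hUo)
    hUc.isPreconnected h2 ?_ ⟨hs, by simp [hR]⟩
  have : {z : ℂ | 1 < z.re} ∈ nhds (2 : ℂ) :=
    (isOpen_lt continuous_const Complex.continuous_re).mem_nhds (by simp)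
  filter_upwards [this] with z hz
  have hz1 : z ≠ 1 := by rintro rfl; simp at hz
  have hz1' : z - 1 ≠ 0 := sub_ne_zero.2 hz1
  rw [(hasSum_zetaTerm_of_one_lt hz).tsum_eq, riemannZeta_eq_inv_sub_mul hz1]
  field_simp
  ring

lemma norm_riemannZeta₀_le {ε : ℝ} (hε : 0 < ε) (hε1 : ε < 1) :
    ∃ K : ℝ, 0 < K ∧ ∀ s : ℂ, s ≠ 1 → 1 - ε / 2 < s.re → ‖riemannZeta₀ s‖ ≤ K * ‖s‖ ^ ε := by
  have hsum := summable_succ_rpow_neg (r := 1 + ε / 2) (by linarith)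
  refine ⟨2 * ∑' n : ℕ, ((n + 1 : ℕ) : ℝ) ^ (-(1 + ε / 2)) + 1, ?_, ?_⟩
  · have : 0 ≤ ∑' n : ℕ, ((n + 1 : ℕ) : ℝ) ^ (-(1 + ε / 2)) := tsum_nonneg fun n => by positivity
    linarith
  intro s h1 hs
  have hn : 0 < ‖s - 1‖ := norm_pos_iff.2 (sub_ne_zero.2 h1)
  have e1 : (s - 1) * riemannZeta₀ s = ∑' n, zetaTerm n s := by
    have := riemannZeta₁_eq_tsum hε hε1 hs
    rw [riemannZeta₁] at this
    linear_combination this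
  have e2 : ‖∑' n, zetaTerm n s‖ ≤
      ∑' n : ℕ, ‖s - 1‖ * (2 * ‖s‖ ^ ε * ((n + 1 : ℕ) : ℝ) ^ (-(1 + ε / 2))) :=
    tsum_of_norm_bounded ((hsum.mul_left _).mul_left _).hasSum
      fun n => norm_zetaTerm_le hε hε1 n hs.le
  rw [← e1, norm_mul, tsum_mul_left, tsum_mul_left] at e2
  have := le_of_mul_le_mul_left e2 hn
  refine this.trans ?_
  have h0 : 0 ≤ ‖s‖ ^ ε := by positivity
  linarith

lemma exists_norm_riemannZeta₀_le :
    ∃ K : ℝ, 1 ≤ K ∧ ∀ s : ℂ, 1 - 1 / 60 < s.re → s.re ≤ 4 →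
      ‖riemannZeta₀ s‖ ≤ K * (1 + |s.im|) ^ (1 / 30 : ℝ) := by
  obtain ⟨K, hK, h⟩ := norm_riemannZeta₀_le (ε := 1 / 30) (by norm_num) (by norm_num)
  refine ⟨1 + K * 4 + ‖riemannZeta₀ 1‖, by have := norm_nonneg (riemannZeta₀ 1); linarith, ?_⟩
  intro s hs hs4
  have hT : (1 : ℝ) ≤ (1 + |s.im|) ^ (1 / 30 : ℝ) :=
    Real.one_le_rpow (by linarith [abs_nonneg s.im]) (by norm_num)
  by_cases h1 : s = 1
  · rw [h1] at hT ⊢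
    nlinarith [norm_nonneg (riemannZeta₀ 1)]
  have hn : ‖s‖ ≤ 4 * (1 + |s.im|) := by
    refine (Complex.norm_le_abs_re_add_abs_im s).trans ?_
    rw [abs_of_pos (by linarith : 0 < s.re)]
    linarith [abs_nonneg s.im]
  have h4 : (4 : ℝ) ^ (1 / 30 : ℝ) ≤ 4 := by
    calc (4 : ℝ) ^ (1 / 30 : ℝ) ≤ 4 ^ (1 : ℝ) :=
          Real.rpow_le_rpow_of_exponent_le (by norm_num) (by norm_num)
      _ = 4 := by norm_num
  calc ‖riemannZeta₀ s‖ ≤ K * ‖s‖ ^ (1 / 30 : ℝ) := h s h1 (by linarith)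
    _ ≤ K * (4 * (1 + |s.im|)) ^ (1 / 30 : ℝ) := by gcongr
    _ = K * (4 ^ (1 / 30 : ℝ) * (1 + |s.im|) ^ (1 / 30 : ℝ)) := by
        rw [Real.mul_rpow (by norm_num) (by positivity)]
    _ ≤ K * (4 * (1 + |s.im|) ^ (1 / 30 : ℝ)) := by gcongr
    _ ≤ _ := by nlinarith [norm_nonneg (riemannZeta₀ 1)]

lemma rpow_le_two_mul_rpow {a b : ℝ} (ha : 0 ≤ a) (hb : 0 ≤ b) (hab : a ≤ 2 * b) :
    a ^ (1 / 30 : ℝ) ≤ 2 * b ^ (1 / 30 : ℝ) := by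
  calc a ^ (1 / 30 : ℝ) ≤ (2 * b) ^ (1 / 30 : ℝ) := by gcongr
    _ = 2 ^ (1 / 30 : ℝ) * b ^ (1 / 30 : ℝ) := Real.mul_rpow (by norm_num) hb
    _ ≤ 2 ^ (1 : ℝ) * b ^ (1 / 30 : ℝ) := by
        gcongr
        · norm_num
        · norm_num
    _ = _ := by norm_num

lemma exists_norm_riemannZeta_and_deriv_le :
    ∃ K : ℝ, 1 ≤ K ∧ ∀ s : ℂ, 1 - 1 / 200 ≤ s.re → s.re ≤ 3 → 1 ≤ |s.im| →
      ‖riemannZeta s‖ ≤ K * (1 + |s.im|) ^ (1 / 30 : ℝ) ∧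
      ‖deriv riemannZeta s‖ ≤ K * (1 + |s.im|) ^ (1 / 30 : ℝ) := by
  obtain ⟨K, hK, h⟩ := exists_norm_riemannZeta₀_le
  refine ⟨1 + 200 * K, by linarith, ?_⟩
  intro s hs hs3 him
  have hT : (1 : ℝ) ≤ (1 + |s.im|) ^ (1 / 30 : ℝ) :=
    Real.one_le_rpow (by linarith [abs_nonneg s.im]) (by norm_num)
  have h1 : s ≠ 1 := by rintro rfl; norm_num at him
  have hn : 1 ≤ ‖s - 1‖ := by
    have := Complex.abs_im_le_norm (s - 1)
    simp only [Complex.sub_im, Complex.one_im, sub_zero] at this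
    linarith
  have hinv : ‖(s - 1)⁻¹‖ ≤ 1 := by
    rw [norm_inv]; exact inv_le_one_of_one_le₀ hn
  constructor
  · rw [riemannZeta_eq_inv_sub_add h1]
    refine (norm_add_le _ _).trans ?_
    have := h s (by linarith) (by linarith)
    nlinarith
  · rw [deriv_riemannZeta_eq_neg_inv_sub_sq_add h1]
    refine (norm_add_le _ _).trans ?_
    have hd : ‖deriv riemannZeta₀ s‖ ≤
        (K * (2 * (1 + |s.im|) ^ (1 / 30 : ℝ))) / (1 / 100) := by
      refine Complex.norm_deriv_le_of_forall_mem_sphere_norm_le (by norm_num)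
        differentiable_riemannZeta₀.diffContOnCl ?_
      intro z hz
      have hz' : ‖z - s‖ = 1 / 100 := by simpa [dist_eq_norm] using hz
      have hre := (abs_le.1 ((Complex.abs_re_le_norm (z - s)).trans hz'.le))
      have hi := ((Complex.abs_im_le_norm (z - s)).trans hz'.le)
      simp only [Complex.sub_re, Complex.sub_im] at hre hi
      refine (h z (by linarith [hre.1]) (by linarith [hre.2])).trans ?_
      gcongr
      refine rpow_le_two_mul_rpow (by positivity) (by positivity) ?_
      have := abs_sub_abs_le_abs_sub z.im s.im
      linarith
    have hi2 : ‖-(s - 1)⁻¹ ^ 2‖ ≤ 1 := by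
      rw [norm_neg, norm_pow]
      exact pow_le_one₀ (norm_nonneg _) hinv
    linarith

lemma exists_cube_le_norm_riemannZeta_pow_four :
    ∃ B : ℝ, 1 ≤ B ∧ ∀ x t : ℝ, 0 < x → x ≤ 1 → 1 ≤ |t| →
      x ^ 3 ≤ B * (1 + |t|) ^ (1 / 30 : ℝ) *
        ‖riemannZeta (1 + x + Complex.I * t)‖ ^ 4 := by
  obtain ⟨K, hK, h⟩ := exists_norm_riemannZeta_and_deriv_le
  obtain ⟨K₀, hK₀, h₀⟩ := exists_norm_riemannZeta₀_le
  refine ⟨(1 + K₀) ^ 3 * (K * 2), ?_, ?_⟩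
  · have : 1 ≤ (1 + K₀) ^ 3 := one_le_pow₀ (by linarith)
    nlinarith
  intro x t hx hx1 ht
  have key := DirichletCharacter.norm_LFunction_product_ge_one (N := 1) 1 hx t
  rw [DirichletCharacter.LFunctionTrivChar] at key
  simp only [one_pow, DirichletCharacter.LFunction_modOne_eq, norm_mul, norm_pow] at key
  have hx1' : (1 + x : ℂ) ≠ 1 := by
    intro h; apply hx.ne'; exact_mod_cast (by linear_combination h : (x : ℂ) = 0)
  have b1 : ‖riemannZeta (1 + x)‖ ≤ (1 + K₀) / x := by
    rw [riemannZeta_eq_inv_sub_add hx1']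
    refine (norm_add_le _ _).trans ?_
    have e1 := h₀ (1 + x) (by simp; linarith) (by simp; linarith)
    have e2 : ‖((1 : ℂ) + x - 1)⁻¹‖ = 1 / x := by
      rw [add_sub_cancel_left, norm_inv, Complex.norm_real, Real.norm_eq_abs, abs_of_pos hx,
        one_div]
    simp only [Complex.add_im, Complex.one_im, Complex.ofReal_im, add_zero, abs_zero,
      Real.one_rpow, mul_one] at e1
    rw [e2, add_div]
    have : K₀ ≤ K₀ / x := by rw [le_div_iff₀ hx]; nlinarith
    linarith
  have b2 : ‖riemannZeta (1 + x + 2 * Complex.I * t)‖ ≤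
      K * (2 * (1 + |t|) ^ (1 / 30 : ℝ)) := by
    have e1 := (h (1 + x + 2 * Complex.I * t) (by simp; linarith) (by simp; linarith)
      (by simp [abs_mul]; linarith)).1
    refine e1.trans ?_
    gcongr
    refine rpow_le_two_mul_rpow (by positivity) (by positivity) ?_
    simp [abs_mul]; linarith
  set M := ‖riemannZeta (1 + x + Complex.I * t)‖ ^ 4
  have hM : 0 ≤ M := by positivity
  have : 1 ≤ ((1 + K₀) / x) ^ 3 * M * (K * (2 * (1 + |t|) ^ (1 / 30 : ℝ))) := by
    refine le_trans key ?_
    gcongr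
  rw [div_pow] at this
  have hx3 : 0 < x ^ 3 := by positivity
  calc x ^ 3 ≤ x ^ 3 * ((1 + K₀) ^ 3 / x ^ 3 * M * (K * (2 * (1 + |t|) ^ (1 / 30 : ℝ)))) := by
        nlinarith
    _ = _ := by field_simp

lemma exists_le_norm_riemannZeta :
    ∃ c : ℝ, 0 < c ∧ ∀ s : ℂ, 1 ≤ s.re → s.re ≤ 2 → 1 ≤ |s.im| →
      c * (((1 + |s.im|) ^ (1 / 30 : ℝ)) ^ 4)⁻¹ ≤ ‖riemannZeta s‖ := by
  obtain ⟨A, hA, h⟩ := exists_norm_riemannZeta_and_deriv_le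
  obtain ⟨B, hB, hcube⟩ := exists_cube_le_norm_riemannZeta_pow_four
  set κ : ℝ := (16 * A ^ 4 * B)⁻¹ with hκ
  have hA4 : 1 ≤ A ^ 4 := one_le_pow₀ hA
  have hden : 1 ≤ 16 * A ^ 4 * B := by nlinarith
  have hκ0 : 0 < κ := by positivity
  have hκ1 : κ ≤ 1 := inv_le_one_of_one_le₀ hden
  refine ⟨A * κ, by positivity, ?_⟩
  intro s hs hs2 him
  set t := s.im
  set y : ℝ := (1 + |t|) ^ (1 / 30 : ℝ) with hy
  have hy1 : 1 ≤ y := Real.one_le_rpow (by linarith [abs_nonneg t]) (by norm_num)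
  have hy0 : 0 < y := by linarith
  set x₀ : ℝ := κ * (y ^ 5)⁻¹ with hx₀
  have hx₀0 : 0 < x₀ := by positivity
  have hx₀1 : x₀ ≤ 1 := by
    have : (y ^ 5)⁻¹ ≤ 1 := inv_le_one_of_one_le₀ (one_le_pow₀ hy1)
    have : 0 < (y ^ 5)⁻¹ := by positivity
    nlinarith
  have hAxy : A * x₀ * y = A * κ * (y ^ 4)⁻¹ := by
    rw [hx₀]; field_simp
  have hlow : ∀ x : ℝ, x₀ ≤ x → x ≤ 1 →
      2 * (A * x₀ * y) ≤ ‖riemannZeta (1 + x + Complex.I * t)‖ := by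
    intro x hx hx1
    have h3 := hcube x t (by linarith) hx1 him
    have h4 : (2 * (A * x₀ * y)) ^ 4 * (B * y) = x₀ ^ 3 := by
      have e : (2 * (A * x₀ * y)) ^ 4 * (B * y) = x₀ ^ 3 * (16 * A ^ 4 * B * (x₀ * y ^ 5)) := by ring
      have e2 : x₀ * y ^ 5 = κ := by rw [hx₀]; field_simp
      rw [e, e2, hκ]
      field_simp
    have h5 : x₀ ^ 3 ≤ x ^ 3 := by gcongr
    have h6 : (2 * (A * x₀ * y)) ^ 4 ≤ ‖riemannZeta (1 + x + Complex.I * t)‖ ^ 4 := by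
      have : 0 < B * y := by positivity
      refine le_of_mul_le_mul_right ?_ this
      linarith
    exact le_of_pow_le_pow_left₀ (by norm_num) (norm_nonneg _) h6
  have hpos : 0 < A * x₀ * y := by positivity
  rw [← hAxy]
  have hs_eq : s = 1 + ((s.re - 1 : ℝ) : ℂ) + Complex.I * t := by
    apply Complex.ext <;> simp [t]
  rcases le_or_gt x₀ (s.re - 1) with hc | hc
  · have := hlow _ hc (by linarith)
    rw [← hs_eq] at this
    linarith
  · have h1 := hlow x₀ le_rfl hx₀1
    set s₁ : ℂ := 1 + x₀ + Complex.I * t with hs₁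
    have hre1 : s₁.re = 1 + x₀ := by simp [s₁]
    have him1 : s₁.im = t := by simp [s₁]
    set S : Set ℂ := {z : ℂ | 1 ≤ z.re} ∩ {z : ℂ | z.re ≤ 2} ∩
      ({z : ℂ | t ≤ z.im} ∩ {z : ℂ | z.im ≤ t}) with hS
    have hSc : Convex ℝ S := ((convex_halfSpace_re_ge _).inter (convex_halfSpace_re_le _)).inter
      ((convex_halfSpace_im_ge _).inter (convex_halfSpace_im_le _))
    have hSim : ∀ z ∈ S, z.im = t := fun z hz => le_antisymm hz.2.2 hz.2.1
    have hd := hSc.norm_image_sub_le_of_norm_deriv_le (f := riemannZeta) (C := A * y)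
      (x := s) (y := s₁) ?_ ?_ ⟨⟨hs, hs2⟩, le_refl s.im, le_refl s.im⟩
      ⟨⟨by simp [hre1, hx₀0.le], by simp [hre1]; linarith⟩, him1.ge, him1.le⟩
    · have hn : ‖s₁ - s‖ ≤ x₀ := by
        have : s₁ - s = ((x₀ - (s.re - 1) : ℝ) : ℂ) := by
          apply Complex.ext
          · simp [hre1]; ring
          · simp [him1, t]
        rw [this, Complex.norm_real, Real.norm_eq_abs, abs_of_pos (by linarith)]
        linarith
      have h2 : ‖riemannZeta s₁ - riemannZeta s‖ ≤ A * y * x₀ :=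
        hd.trans (by gcongr)
      have h3 := norm_sub_norm_le (riemannZeta s₁) (riemannZeta s)
      nlinarith
    · intro z hz
      refine differentiableAt_riemannZeta ?_
      rintro rfl
      have := hSim 1 hz
      rw [← this] at him
      norm_num at him
    · intro z hz
      have := (h z (by linarith [hz.1.1.out]) (by linarith [hz.1.2.out])
        (by rw [hSim z hz]; exact him)).2
      rwa [hSim z hz] at this

lemma exists_norm_iteratedDeriv_le_of_two_le_im :
    ∃ K : ℝ, 0 < K ∧ ∀ s : ℂ, 1 ≤ s.re → s.re ≤ 2 → 2 ≤ |s.im| →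
      ‖iteratedDeriv 2 (fun z => -deriv riemannZeta z / riemannZeta z - riemannZeta z) s‖ ≤
        K * (1 + |s.im|) ^ (1 / 2 : ℝ) := by
  obtain ⟨A, hA, h⟩ := exists_norm_riemannZeta_and_deriv_le
  obtain ⟨c, hc, hlow⟩ := exists_le_norm_riemannZeta
  set c₁ : ℝ := min (1 / 200) (c / (4 * A)) with hc₁
  have hc₁0 : 0 < c₁ := lt_min (by norm_num) (by positivity)
  have hc₁1 : c₁ ≤ 1 / 200 := min_le_left _ _
  have hc₁2 : c₁ * (4 * A) ≤ c := (le_div_iff₀ (by positivity)).1 (min_le_right _ _)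
  refine ⟨2 * (4 * A / c + 2 * A) / c₁ ^ 2, by positivity, ?_⟩
  intro s hs hs2 him
  set y : ℝ := (1 + |s.im|) ^ (1 / 30 : ℝ) with hy
  have hy1 : 1 ≤ y := Real.one_le_rpow (by linarith [abs_nonneg s.im]) (by norm_num)
  have hy0 : 0 < y := by linarith
  set r : ℝ := c₁ * (y ^ 5)⁻¹ with hr
  have hr0 : 0 < r := by positivity
  have hrc : r ≤ c₁ := by
    have : (y ^ 5)⁻¹ ≤ 1 := inv_le_one_of_one_le₀ (one_le_pow₀ hy1)
    nlinarith
  have hball : ∀ z ∈ Metric.closedBall s r, 1 - 1 / 200 ≤ z.re ∧ z.re ≤ 3 ∧ 1 ≤ |z.im| ∧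
      (1 + |z.im|) ^ (1 / 30 : ℝ) ≤ 2 * y := by
    intro z hz
    have hz' : ‖z - s‖ ≤ r := by simpa [dist_eq_norm] using hz
    have hre := (abs_le.1 ((Complex.abs_re_le_norm (z - s)).trans hz'))
    have hi := ((Complex.abs_im_le_norm (z - s)).trans hz')
    simp only [Complex.sub_re, Complex.sub_im] at hre hi
    have k1 := abs_sub_abs_le_abs_sub z.im s.im
    have k2 := abs_sub_abs_le_abs_sub s.im z.im
    rw [abs_sub_comm] at k2
    refine ⟨by linarith [hre.1], by linarith [hre.2], by linarith, ?_⟩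
    exact rpow_le_two_mul_rpow (by positivity) (by positivity) (by linarith)
  have hne1 : ∀ z ∈ Metric.closedBall s r, z ≠ 1 := by
    rintro z hz rfl
    have := (hball 1 hz).2.2.1
    norm_num at this
  have hzl : ∀ z ∈ Metric.closedBall s r, c / 2 * (y ^ 4)⁻¹ ≤ ‖riemannZeta z‖ := by
    intro z hz
    have hd := (convex_closedBall s r).norm_image_sub_le_of_norm_deriv_le (f := riemannZeta)
      (C := A * (2 * y)) (x := z) (y := s) (fun w hw => differentiableAt_riemannZeta (hne1 w hw))
      (fun w hw => ((h w (hball w hw).1 (hball w hw).2.1 (hball w hw).2.2.1).2).trans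
        (by gcongr; exact (hball w hw).2.2.2)) hz (Metric.mem_closedBall_self hr0.le)
    have hz' : ‖s - z‖ ≤ r := by rw [norm_sub_rev]; simpa [dist_eq_norm] using hz
    have h2 : ‖riemannZeta s - riemannZeta z‖ ≤ A * (2 * y) * r := hd.trans (by gcongr)
    have h3 := norm_sub_norm_le (riemannZeta s) (riemannZeta z)
    have h4 := hlow s hs hs2 (by linarith)
    have h5 : A * (2 * y) * r = (c₁ * (4 * A)) / 2 * (y ^ 4)⁻¹ := by
      rw [hr]; field_simp; ring
    have h6 : (c₁ * (4 * A)) / 2 * (y ^ 4)⁻¹ ≤ c / 2 * (y ^ 4)⁻¹ := by gcongr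
    change c * (y ^ 4)⁻¹ ≤ _ at h4
    linarith
  have hF : ∀ z ∈ Metric.closedBall s r,
      ‖-deriv riemannZeta z / riemannZeta z - riemannZeta z‖ ≤ (4 * A / c + 2 * A) * y ^ 5 := by
    intro z hz
    obtain ⟨b1, b2, b3, b4⟩ := hball z hz
    obtain ⟨z1, z2⟩ := h z b1 b2 b3
    have z1' : ‖riemannZeta z‖ ≤ A * (2 * y) := z1.trans (by gcongr)
    have z2' : ‖deriv riemannZeta z‖ ≤ A * (2 * y) := z2.trans (by gcongr)
    refine (norm_sub_le _ _).trans ?_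
    rw [norm_div, norm_neg]
    have l : ‖deriv riemannZeta z‖ / ‖riemannZeta z‖ ≤ A * (2 * y) / (c / 2 * (y ^ 4)⁻¹) := by
      gcongr
      exact hzl z hz
    have l2 : A * (2 * y) / (c / 2 * (y ^ 4)⁻¹) = 4 * A / c * y ^ 5 := by field_simp; ring
    have l3 : y ≤ y ^ 5 := le_self_pow₀ hy1 (by norm_num)
    rw [l2] at l
    nlinarith
  have hdiff : DiffContOnCl ℂ (fun z => -deriv riemannZeta z / riemannZeta z - riemannZeta z)
      (Metric.ball s r) := by
    apply DifferentiableOn.diffContOnCl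
    rw [closure_ball _ hr0.ne']
    intro z hz
    have ho : IsOpen ({1}ᶜ : Set ℂ) := isOpen_compl_singleton
    have hdz : DifferentiableAt ℂ (deriv riemannZeta) z :=
      (differentiableOn_riemannZeta.deriv ho).differentiableAt (ho.mem_nhds (hne1 z hz))
    have hzz := differentiableAt_riemannZeta (hne1 z hz)
    have hne : riemannZeta z ≠ 0 := by
      intro h0
      have := hzl z hz
      rw [h0, norm_zero] at this
      have : 0 < c / 2 * (y ^ 4)⁻¹ := by positivity
      linarith
    exact ((hdz.neg.div hzz hne).sub hzz).differentiableWithinAt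
  have := Complex.norm_iteratedDeriv_le_of_forall_mem_sphere_norm_le 2 hr0 hdiff
    (fun z hz => hF z (Metric.sphere_subset_closedBall hz))
  refine this.trans (le_of_eq ?_)
  have hy15 : (1 + |s.im|) ^ (1 / 2 : ℝ) = y ^ 15 := by
    rw [hy, ← Real.rpow_natCast, ← Real.rpow_mul (by positivity)]
    norm_num
  rw [hy15, hr]
  simp only [Nat.factorial]
  field_simp
  norm_num

/-- The coefficients of `-ζ'/ζ - ζ`. -/
noncomputable def vonMangoldtSubOne (n : ℕ) : ℂ := (ArithmeticFunction.vonMangoldt n : ℂ) - 1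

lemma abscissaOfAbsConv_vonMangoldtSubOne_lt {s : ℂ} (hs : 1 < s.re) :
    LSeries.abscissaOfAbsConv vonMangoldtSubOne < s.re := by
  have h1 : LSeries.abscissaOfAbsConv vonMangoldtSubOne ≤ 1 := by
    refine (LSeries.abscissaOfAbsConv_sub_le
      (fun n => (ArithmeticFunction.vonMangoldt n : ℂ)) 1).trans (max_le ?_ ?_)
    · exact_mod_cast LSeries.abscissaOfAbsConv_le_of_forall_lt_LSeriesSummable (x := 1)
        (fun y hy => ArithmeticFunction.LSeriesSummable_vonMangoldt (by simpa using hy))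
    · exact LSeries.abscissaOfAbsConv_one.le
  exact h1.trans_lt (by exact_mod_cast hs)

lemma LSeries_vonMangoldtSubOne {s : ℂ} (hs : 1 < s.re) :
    LSeries vonMangoldtSubOne s = -deriv riemannZeta s / riemannZeta s - riemannZeta s := by
  rw [← ArithmeticFunction.LSeries_vonMangoldt_eq_deriv_riemannZeta_div hs,
    ← LSeries_one_eq_riemannZeta hs,
    ← LSeries_sub (ArithmeticFunction.LSeriesSummable_vonMangoldt hs) (LSeriesSummable_one_iff.2 hs)]
  rfl

lemma riemannZeta₁_ne_zero {s : ℂ} (hs : 1 ≤ s.re) : riemannZeta₁ s ≠ 0 := by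
  by_cases h1 : s = 1
  · subst h1; simp
  have := riemannZeta_ne_zero_of_one_le_re hs
  rw [riemannZeta_eq_inv_sub_mul h1] at this
  exact right_ne_zero_of_mul this

lemma LSeries_vonMangoldtSubOne' {s : ℂ} (hs : 1 < s.re) :
    LSeries vonMangoldtSubOne s =
      -deriv riemannZeta₁ s / riemannZeta₁ s - riemannZeta₀ s := by
  have h1 : s ≠ 1 := by rintro rfl; simp at hs
  have h1' : s - 1 ≠ 0 := sub_ne_zero.2 h1
  have := riemannZeta₁_ne_zero hs.le
  rw [LSeries_vonMangoldtSubOne hs, deriv_riemannZeta_eq_neg_inv_sub_sq_mul_add h1]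
  conv_lhs => rw [sub_eq_add_neg]; arg 2; rw [riemannZeta_eq_inv_sub_add h1]
  rw [riemannZeta_eq_inv_sub_mul h1]
  field_simp
  ring

lemma exists_norm_LSeries_logMul_le :
    ∃ K : ℝ, 0 < K ∧ ∀ s : ℂ, 1 < s.re → s.re ≤ 2 →
      ‖LSeries (LSeries.logMul^[2] vonMangoldtSubOne) s‖ ≤ K * (1 + |s.im|) ^ (1 / 2 : ℝ) := by
  obtain ⟨K, hK, h⟩ := exists_norm_iteratedDeriv_le_of_two_le_im
  set G : ℂ → ℂ := fun z => -deriv riemannZeta₁ z / riemannZeta₁ z - riemannZeta₀ z with hG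
  set U : Set ℂ := {z | riemannZeta₁ z ≠ 0} with hU
  have hUo : IsOpen U := isOpen_ne_fun differentiable_riemannZeta₁.continuous continuous_const
  have hGd : DifferentiableOn ℂ G U := by
    intro z hz
    have hz' : riemannZeta₁ z ≠ 0 := hz
    have h1 : DifferentiableAt ℂ (deriv riemannZeta₁) z := differentiable_riemannZeta₁.deriv z
    exact ((h1.neg.div (differentiable_riemannZeta₁ z) hz').sub
      (differentiable_riemannZeta₀ z)).differentiableWithinAt
  have hcont : ContinuousOn (iteratedDeriv 2 G) U := by
    have := ((hGd.analyticOnNhd hUo).deriv.deriv).continuousOn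
    rwa [iteratedDeriv_succ, iteratedDeriv_one]
  have hcomp : IsCompact (Set.Icc (1 : ℝ) 2 ×ℂ Set.Icc (-2 : ℝ) 2) :=
    isCompact_Icc.reProdIm isCompact_Icc
  obtain ⟨K₁, hK₁⟩ := hcomp.exists_bound_of_continuousOn
    (hcont.mono fun z hz => riemannZeta₁_ne_zero hz.1.1)
  refine ⟨K + |K₁|, by positivity, ?_⟩
  intro s hs hs2
  have hT : (1 : ℝ) ≤ (1 + |s.im|) ^ (1 / 2 : ℝ) :=
    Real.one_le_rpow (by linarith [abs_nonneg s.im]) (by norm_num)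
  have hL := LSeries_iteratedDeriv 2 (abscissaOfAbsConv_vonMangoldtSubOne_lt hs)
  have hnhds : {z : ℂ | 1 < z.re} ∈ nhds s :=
    (isOpen_lt continuous_const Complex.continuous_re).mem_nhds hs
  rw [show LSeries (LSeries.logMul^[2] vonMangoldtSubOne) s =
    iteratedDeriv 2 (LSeries vonMangoldtSubOne) s by rw [hL]; norm_num]
  have hK₁' := le_abs_self K₁
  rcases le_or_gt 2 |s.im| with him | him
  · have e : LSeries vonMangoldtSubOne =ᶠ[nhds s]
        (fun z => -deriv riemannZeta z / riemannZeta z - riemannZeta z) := by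
      filter_upwards [hnhds] with z hz using LSeries_vonMangoldtSubOne hz
    rw [e.iteratedDeriv_eq]
    have := h s hs.le hs2 him
    nlinarith [abs_nonneg K₁]
  · have e : LSeries vonMangoldtSubOne =ᶠ[nhds s] G := by
      filter_upwards [hnhds] with z hz using LSeries_vonMangoldtSubOne' hz
    rw [e.iteratedDeriv_eq]
    have := hK₁ s ⟨⟨hs.le, hs2⟩, abs_le.1 him.le⟩
    nlinarith [abs_nonneg K₁]

/-- The Cesàro kernel `max 0 (1 - y)` on the positive half-line, written as a difference of
powers. -/
noncomputable def cesaroKernel (y : ℝ) : ℂ :=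
  (Set.Ioc (0 : ℝ) 1).indicator (fun _ => (1 : ℂ)) y -
    (Set.Ioc (0 : ℝ) 1).indicator (fun t => (t : ℂ) ^ (1 : ℂ)) y

lemma cesaroKernel_of_pos {y : ℝ} (hy : 0 < y) : cesaroKernel y = ((max 0 (1 - y) : ℝ) : ℂ) := by
  unfold cesaroKernel
  by_cases h : y ≤ 1
  · have hm : y ∈ Set.Ioc (0 : ℝ) 1 := ⟨hy, h⟩
    rw [Set.indicator_of_mem hm, Set.indicator_of_mem hm, max_eq_right (by linarith)]
    simp
  · have hm : y ∉ Set.Ioc (0 : ℝ) 1 := fun h' => h h'.2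
    rw [Set.indicator_of_notMem hm, Set.indicator_of_notMem hm, max_eq_left (by linarith)]
    simp

lemma hasMellin_cesaroKernel {s : ℂ} (hs : 0 < s.re) :
    HasMellin cesaroKernel s (1 / (s * (s + 1))) := by
  have h1 := hasMellin_one_Ioc hs
  have h2 := hasMellin_cpow_Ioc 1 (s := s) (by simp; linarith)
  have h := hasMellin_sub h1.1 h2.1
  refine ⟨h.1, h.2.trans ?_⟩
  rw [h1.2, h2.2]
  have e1 : s ≠ 0 := by rintro rfl; simp at hs
  have e2 : s + 1 ≠ 0 := by
    intro h
    have := congrArg Complex.re h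
    simp at this; linarith
  field_simp
  ring

lemma norm_one_div_mul_succ_le {c : ℝ} (hc : 1 ≤ c) (t : ℝ) :
    ‖1 / (((c : ℂ) + t * Complex.I) * ((c : ℂ) + t * Complex.I + 1))‖ ≤
      4 * (1 + |t|) ^ (-2 : ℝ) := by
  have ht := abs_nonneg t
  have key : ∀ d : ℝ, 1 ≤ d → (1 + |t|) / 2 ≤ ‖(d : ℂ) + t * Complex.I‖ := by
    intro d hd
    have h1 := Complex.abs_re_le_norm ((d : ℂ) + t * Complex.I)
    have h2 := Complex.abs_im_le_norm ((d : ℂ) + t * Complex.I)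
    simp at h1 h2
    have := le_abs_self d
    linarith
  have k1 := key c hc
  have k2 := key (c + 1) (by linarith)
  have e : ((c + 1 : ℝ) : ℂ) + t * Complex.I = (c : ℂ) + t * Complex.I + 1 := by
    push_cast; ring
  rw [e] at k2
  rw [norm_div, norm_one, norm_mul, Real.rpow_neg (by positivity)]
  calc _ ≤ 1 / ((1 + |t|) / 2 * ((1 + |t|) / 2)) := by gcongr
    _ = _ := by
      rw [show (2 : ℝ) = ((2 : ℕ) : ℝ) by norm_num, Real.rpow_natCast]
      field_simp
      norm_num

lemma continuous_one_div_mul_succ {c : ℝ} (hc : 1 ≤ c) :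
    Continuous fun t : ℝ => 1 / (((c : ℂ) + t * Complex.I) * ((c : ℂ) + t * Complex.I + 1)) := by
  refine continuous_const.div (by fun_prop) fun t => mul_ne_zero ?_ ?_
  · intro h
    have := congrArg Complex.re h
    simp at this; linarith
  · intro h
    have := congrArg Complex.re h
    simp at this; linarith

lemma integrable_one_add_abs_rpow {r : ℝ} (hr : 1 < r) :
    Integrable fun t : ℝ => (1 + |t|) ^ (-r) := by
  have := integrable_one_add_norm (E := ℝ) (μ := volume) (r := r) (by simpa using hr)
  simpa using this

lemma integrable_one_div_mul_succ {c : ℝ} (hc : 1 ≤ c) :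
    Integrable fun t : ℝ =>
      1 / (((c : ℂ) + t * Complex.I) * ((c : ℂ) + t * Complex.I + 1)) :=
  ((integrable_one_add_abs_rpow (r := 2) (by norm_num)).const_mul 4).mono'
    (continuous_one_div_mul_succ hc).aestronglyMeasurable
    (Filter.Eventually.of_forall fun t => norm_one_div_mul_succ_le hc t)

lemma integral_cpow_mul_one_div_mul_succ {c : ℝ} (hc : 1 ≤ c) {y : ℝ} (hy : 0 < y) :
    (1 / (2 * Real.pi)) • ∫ t : ℝ, (y : ℂ) ^ (-((c : ℂ) + t * Complex.I)) *
      (1 / (((c : ℂ) + t * Complex.I) * ((c : ℂ) + t * Complex.I + 1))) =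
      ((max 0 (1 - y) : ℝ) : ℂ) := by
  have hre : ∀ t : ℝ, 0 < ((c : ℂ) + t * Complex.I).re := by intro t; simp; linarith
  have hm : ∀ t : ℝ, mellin cesaroKernel ((c : ℂ) + t * Complex.I) =
      1 / (((c : ℂ) + t * Complex.I) * ((c : ℂ) + t * Complex.I + 1)) :=
    fun t => (hasMellin_cesaroKernel (hre t)).2
  have h := mellinInv_mellin_eq c cesaroKernel hy
    (hasMellin_cesaroKernel (by simp; linarith)).1 ?_ ?_
  · rw [cesaroKernel_of_pos hy, mellinInv] at h
    simpa only [hm, smul_eq_mul] using h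
  · unfold Complex.VerticalIntegrable
    simp_rw [hm]
    exact integrable_one_div_mul_succ hc
  · have hc' : ContinuousAt (fun y : ℝ => ((max 0 (1 - y) : ℝ) : ℂ)) y := by fun_prop
    refine hc'.congr ?_
    filter_upwards [lt_mem_nhds hy] with z hz using (cesaroKernel_of_pos hz).symm

lemma ofReal_div_cpow_neg {a b : ℝ} (ha : 0 < a) (hb : 0 < b) (s : ℂ) :
    ((a / b : ℝ) : ℂ) ^ (-s) = (b : ℂ) ^ s / (a : ℂ) ^ s := by
  have ha' : (a : ℂ) ≠ 0 := by exact_mod_cast ha.ne'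
  have hb' : (b : ℂ) ≠ 0 := by exact_mod_cast hb.ne'
  have hab : ((a / b : ℝ) : ℂ) ≠ 0 := by exact_mod_cast (div_pos ha hb).ne'
  rw [Complex.cpow_def_of_ne_zero ha', Complex.cpow_def_of_ne_zero hb',
    Complex.cpow_def_of_ne_zero hab, ← Complex.exp_sub, ← Complex.ofReal_log ha.le,
    ← Complex.ofReal_log hb.le, ← Complex.ofReal_log (div_pos ha hb).le,
    Real.log_div ha.ne' hb.ne']
  push_cast
  ring_nf

/-- If the Dirichlet series of `f` grows at most like `|t| ^ (1/2)` in the strip `1 < σ ≤ 2`, then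
the Cesàro means of `f` are bounded linearly. -/
lemma norm_tsum_mul_max_le {f : ℕ → ℂ} {K : ℝ}
    (hf : ∀ s : ℂ, 1 < s.re → LSeriesSummable f s)
    (hK : ∀ s : ℂ, 1 < s.re → s.re ≤ 2 → ‖LSeries f s‖ ≤ K * (1 + |s.im|) ^ (1 / 2 : ℝ))
    (hf0 : f 0 = 0) {x : ℝ} (hx : 0 < x) :
    ‖∑' n, f n * ((max 0 (1 - n / x) : ℝ) : ℂ)‖ ≤
      4 * K * (∫ t : ℝ, (1 + |t|) ^ (-(3 / 2) : ℝ)) * x := by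
  set J := ∫ t : ℝ, (1 + |t|) ^ (-(3 / 2) : ℝ) with hJ
  have main : ∀ c : ℝ, 1 < c → c ≤ 2 →
      ‖∑' n, f n * ((max 0 (1 - n / x) : ℝ) : ℂ)‖ ≤ 4 * K * J * x ^ c := by
    intro c hc hc2
    set S : ℝ → ℂ := fun t => (c : ℂ) + t * Complex.I with hS
    have hSre : ∀ t, (S t).re = c := fun t => by simp [S]
    have hSim : ∀ t, (S t).im = t := fun t => by simp [S]
    set W : ℝ → ℂ := fun t => 1 / (S t * (S t + 1)) with hW
    have hWi : Integrable W := integrable_one_div_mul_succ hc.le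
    have hxc : ∀ t, ‖(x : ℂ) ^ S t‖ = x ^ c := fun t => by
      rw [Complex.norm_cpow_eq_rpow_re_of_pos hx, hSre]
    have hx0 : (x : ℂ) ≠ 0 := by exact_mod_cast hx.ne'
    set F : ℕ → ℝ → ℂ := fun n t => LSeries.term f (S t) n * ((x : ℂ) ^ S t * W t) with hF
    have hxW : Integrable fun t => (x : ℂ) ^ S t * W t := by
      refine hWi.bdd_mul (c := x ^ c) ?_ (Filter.Eventually.of_forall fun t => (hxc t).le)
      refine Continuous.aestronglyMeasurable ?_
      exact Continuous.const_cpow (by fun_prop) (Or.inl hx0)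
    have htn : ∀ n t, ‖LSeries.term f (S t) n‖ = ‖LSeries.term f c n‖ := by
      intro n t
      rw [LSeries.norm_term_eq, LSeries.norm_term_eq, hSre, Complex.ofReal_re]
    have hFi : ∀ n, Integrable (F n) := by
      intro n
      refine hxW.bdd_mul (c := ‖LSeries.term f c n‖) ?_
        (Filter.Eventually.of_forall fun t => (htn n t).le)
      refine Continuous.aestronglyMeasurable ?_
      by_cases hn : n = 0
      · subst hn; simp only [LSeries.term_zero]; exact continuous_const
      · simp only [LSeries.term_of_ne_zero hn]
        have hn' : (n : ℂ) ≠ 0 := by exact_mod_cast hn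
        refine continuous_const.div (Continuous.const_cpow (by fun_prop) (Or.inl hn')) fun t => ?_
        simp [Complex.cpow_eq_zero_iff, hn']
    have hFs : Summable fun n => ∫ t, ‖F n t‖ := by
      have : ∀ n, ∫ t, ‖F n t‖ = ‖LSeries.term f c n‖ * (x ^ c * ∫ t, ‖W t‖) := by
        intro n
        simp only [F, norm_mul, htn, hxc]
        rw [integral_const_mul, integral_const_mul]
      simp_rw [this]
      exact ((hf c (by simpa using hc)).norm).mul_right _
    have hFint : ∀ n, (1 / (2 * Real.pi)) • ∫ t, F n t = f n * ((max 0 (1 - n / x) : ℝ) : ℂ) := by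
      intro n
      by_cases hn : n = 0
      · subst hn; simp [F, hf0]
      have hn' : (0 : ℝ) < n := by exact_mod_cast Nat.pos_of_ne_zero hn
      rw [← integral_cpow_mul_one_div_mul_succ hc.le (div_pos hn' hx), mul_smul_comm,
        ← integral_const_mul]
      congr 2
      funext t
      simp only [F, LSeries.term_of_ne_zero hn]
      rw [ofReal_div_cpow_neg hn' hx]
      simp only [Complex.ofReal_natCast]
      change _ = f n * ((x : ℂ) ^ S t / (n : ℂ) ^ S t * W t)
      ring
    have hsum : ∑' n, f n * ((max 0 (1 - n / x) : ℝ) : ℂ) =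
        (1 / (2 * Real.pi)) • ∫ t, LSeries f (S t) * ((x : ℂ) ^ S t * W t) := by
      simp_rw [← hFint]
      rw [tsum_const_smul'', integral_tsum_of_summable_integral_norm hFi hFs]
      congr 2
      funext t
      simp only [F, tsum_mul_right, LSeries]
    have h_int : ‖∫ t, LSeries f (S t) * ((x : ℂ) ^ S t * W t)‖ ≤
        ∫ t : ℝ, 4 * K * x ^ c * (1 + |t|) ^ (-(3 / 2) : ℝ) := by
      refine norm_integral_le_of_norm_le
        ((integrable_one_add_abs_rpow (by norm_num)).const_mul _)
        (Filter.Eventually.of_forall fun t => ?_)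
      have h1 := hK (S t) (by rw [hSre]; exact hc) (by rw [hSre]; exact hc2)
      rw [hSim] at h1
      have h2 : ‖W t‖ ≤ 4 * (1 + |t|) ^ (-2 : ℝ) := norm_one_div_mul_succ_le hc.le t
      rw [norm_mul, norm_mul, hxc]
      have h0 : 0 < 1 + |t| := by positivity
      calc _ ≤ K * (1 + |t|) ^ (1 / 2 : ℝ) * (x ^ c * (4 * (1 + |t|) ^ (-2 : ℝ))) := by
            gcongr
            exact (norm_nonneg _).trans h1
        _ = 4 * K * x ^ c * ((1 + |t|) ^ (1 / 2 : ℝ) * (1 + |t|) ^ (-2 : ℝ)) := by ring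
        _ = _ := by rw [← Real.rpow_add h0]; norm_num
    rw [integral_const_mul] at h_int
    rw [hsum, norm_smul, Real.norm_eq_abs, abs_of_pos (by positivity)]
    have hpi : 1 / (2 * Real.pi) ≤ 1 := by
      rw [div_le_one (by positivity)]; linarith [Real.pi_gt_three]
    calc _ ≤ 1 * ‖∫ t, LSeries f (S t) * ((x : ℂ) ^ S t * W t)‖ := by gcongr
      _ ≤ 4 * K * x ^ c * J := by rw [one_mul]; exact h_int
      _ = 4 * K * J * x ^ c := by ring
  have hlim : Filter.Tendsto (fun c : ℝ => 4 * K * J * x ^ c) (nhdsWithin 1 (Set.Ioi 1))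
      (nhds (4 * K * J * x ^ (1 : ℝ))) := by
    refine Filter.Tendsto.mono_left ?_ nhdsWithin_le_nhds
    exact ((Real.continuousAt_const_rpow hx.ne').tendsto).const_mul _
  rw [Real.rpow_one] at hlim
  refine ge_of_tendsto hlim ?_
  filter_upwards [Ioc_mem_nhdsGT (show (1 : ℝ) < 2 by norm_num)] with c hc
    using main c hc.1 hc.2

lemma logMul_iterate_two_vonMangoldtSubOne (n : ℕ) :
    LSeries.logMul^[2] vonMangoldtSubOne n =
      (((ArithmeticFunction.vonMangoldt n - 1) * Real.log n ^ 2 : ℝ) : ℂ) := by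
  simp only [Function.iterate_succ, Function.iterate_zero, Function.comp, id, LSeries.logMul,
    vonMangoldtSubOne, ← Complex.natCast_log]
  push_cast
  ring

lemma exists_abs_sum_vonMangoldt_sub_one_mul_log_sq_le :
    ∃ K : ℝ, 0 < K ∧ ∀ x : ℝ, 0 < x → ∀ N : ℕ, x ≤ N →
      |∑ n ∈ Finset.range N, (ArithmeticFunction.vonMangoldt n - 1) * Real.log n ^ 2 *
        max 0 (x - n)| ≤ K * x ^ 2 := by
  obtain ⟨K, hK, h⟩ := exists_norm_LSeries_logMul_le
  set J := ∫ t : ℝ, (1 + |t|) ^ (-(3 / 2) : ℝ) with hJ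
  have hJ0 : 0 ≤ J := integral_nonneg fun t => by positivity
  refine ⟨4 * K * J + 1, by positivity, ?_⟩
  intro x hx N hN
  have h1 := norm_tsum_mul_max_le (f := LSeries.logMul^[2] vonMangoldtSubOne) (K := K)
    (fun s hs => LSeriesSummable_of_abscissaOfAbsConv_lt_re (by
      rw [LSeries.absicssaOfAbsConv_logPowMul]
      exact abscissaOfAbsConv_vonMangoldtSubOne_lt hs)) h
    (by rw [logMul_iterate_two_vonMangoldtSubOne]; simp) hx
  rw [tsum_eq_sum (s := Finset.range N)] at h1
  · simp_rw [logMul_iterate_two_vonMangoldtSubOne, ← Complex.ofReal_mul, ← Complex.ofReal_sum] at h1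
    rw [Complex.norm_real, Real.norm_eq_abs] at h1
    have e : ∑ n ∈ Finset.range N, (ArithmeticFunction.vonMangoldt n - 1) * Real.log n ^ 2 *
        max 0 (x - n) = x * ∑ n ∈ Finset.range N, (ArithmeticFunction.vonMangoldt n - 1) *
          Real.log n ^ 2 * max 0 (1 - n / x) := by
      rw [Finset.mul_sum]
      refine Finset.sum_congr rfl fun n _ => ?_
      have : max 0 (x - n) = x * max 0 (1 - n / x) := by
        rw [mul_max_of_nonneg _ _ hx.le, mul_zero, mul_sub, mul_one, mul_div_cancel₀ _ hx.ne']
      rw [this]; ring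
    rw [e, abs_mul, abs_of_pos hx]
    change _ ≤ 4 * K * J * x at h1
    nlinarith [mul_le_mul_of_nonneg_left h1 hx.le, sq_nonneg x]
  · intro n hn
    have hn' : x ≤ n := hN.trans (by exact_mod_cast (not_lt.1 fun h => hn (Finset.mem_range.2 h)))
    have : 1 - n / x ≤ 0 := by
      rw [sub_nonpos, le_div_iff₀ hx]; linarith
    rw [max_eq_left this]; simp

/-- The summatory function of `w` over the positive integers up to `x`. -/
noncomputable def summatory (w : ℕ → ℝ) (x : ℝ) : ℝ := ∑ n ∈ Finset.Ioc 0 ⌊x⌋₊, w n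

lemma summatory_eq_sum_range {w : ℕ → ℝ} (hw0 : w 0 = 0) {y : ℝ} (hy : 0 ≤ y) {N : ℕ}
    (hN : y < N) :
    summatory w y = ∑ n ∈ Finset.range N, w n * if (n : ℝ) ≤ y then 1 else 0 := by
  unfold summatory
  simp only [mul_ite, mul_one, mul_zero]
  rw [← Finset.sum_filter]
  refine Finset.sum_subset (fun n hn => ?_) (fun n hn hn' => ?_)
  · rw [Finset.mem_Ioc] at hn
    have := (Nat.le_floor_iff hy).1 hn.2
    rw [Finset.mem_filter, Finset.mem_range]
    exact ⟨by exact_mod_cast this.trans_lt hN, this⟩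
  · rw [Finset.mem_filter] at hn
    have : n = 0 := by
      by_contra h
      exact hn' (Finset.mem_Ioc.2 ⟨Nat.pos_of_ne_zero h, Nat.le_floor hn.2⟩)
    rw [this, hw0]

lemma mul_summatory_le {w : ℕ → ℝ} (hw : ∀ n, 0 ≤ w n) (hw0 : w 0 = 0) {y z : ℝ} (hy : 0 ≤ y)
    (hyz : y ≤ z) {N : ℕ} (hN : z < N) :
    (z - y) * summatory w y ≤
      ∑ n ∈ Finset.range N, w n * max 0 (z - n) - ∑ n ∈ Finset.range N, w n * max 0 (y - n) := by
  rw [summatory_eq_sum_range hw0 hy (hyz.trans_lt hN), ← Finset.sum_sub_distrib, Finset.mul_sum]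
  refine Finset.sum_le_sum fun n _ => ?_
  rw [← mul_sub, mul_left_comm]
  refine mul_le_mul_of_nonneg_left ?_ (hw n)
  split_ifs with h
  · rw [max_eq_right (by linarith), max_eq_right (by linarith)]; linarith
  · rw [mul_zero, sub_nonneg]; gcongr

lemma le_mul_summatory {w : ℕ → ℝ} (hw : ∀ n, 0 ≤ w n) (hw0 : w 0 = 0) {y z : ℝ} (hy : 0 ≤ y)
    (hyz : y ≤ z) {N : ℕ} (hN : z < N) :
    ∑ n ∈ Finset.range N, w n * max 0 (z - n) - ∑ n ∈ Finset.range N, w n * max 0 (y - n) ≤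
      (z - y) * summatory w z := by
  rw [summatory_eq_sum_range hw0 (hy.trans hyz) hN, ← Finset.sum_sub_distrib, Finset.mul_sum]
  refine Finset.sum_le_sum fun n _ => ?_
  rw [← mul_sub, mul_left_comm]
  refine mul_le_mul_of_nonneg_left ?_ (hw n)
  split_ifs with h
  · rw [max_eq_right (by linarith : 0 ≤ z - n)]
    linarith [le_max_right 0 (y - n)]
  · rw [max_eq_left (by linarith), max_eq_left (by linarith)]; simp

lemma summatory_sub (w : ℕ → ℝ) {y z : ℝ} (hyz : y ≤ z) :
    summatory w z - summatory w y = ∑ n ∈ Finset.Ioc ⌊y⌋₊ ⌊z⌋₊, w n := by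
  unfold summatory
  rw [sub_eq_iff_eq_add', Finset.sum_Ioc_consecutive _ (Nat.zero_le _) (Nat.floor_le_floor hyz)]

lemma card_Ioc_floor_le {y z : ℝ} (hy : 0 ≤ y) (hyz : y ≤ z) :
    ((Finset.Ioc ⌊y⌋₊ ⌊z⌋₊).card : ℝ) ≤ z - y + 1 := by
  rw [Nat.card_Ioc, Nat.cast_sub (Nat.floor_le_floor hyz)]
  linarith [Nat.floor_le (hy.trans hyz), Nat.lt_floor_add_one y]

lemma le_card_Ioc_floor {y z : ℝ} (hy : 0 ≤ y) (hyz : y ≤ z) :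
    z - y - 1 ≤ ((Finset.Ioc ⌊y⌋₊ ⌊z⌋₊).card : ℝ) := by
  rw [Nat.card_Ioc, Nat.cast_sub (Nat.floor_le_floor hyz)]
  linarith [Nat.floor_le hy, Nat.lt_floor_add_one z]

lemma summatory_log_sq_sub_le {y z : ℝ} (hy : 0 ≤ y) (hyz : y ≤ z) :
    summatory (fun n => Real.log n ^ 2) z - summatory (fun n => Real.log n ^ 2) y ≤
      (z - y + 1) * Real.log z ^ 2 := by
  rw [summatory_sub _ hyz]
  refine (Finset.sum_le_card_nsmul _ _ (Real.log z ^ 2) fun n hn => ?_).trans ?_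
  · rw [Finset.mem_Ioc] at hn
    have hn0 : 0 < n := by omega
    have h1 : (n : ℝ) ≤ z := (Nat.le_floor_iff (hy.trans hyz)).1 hn.2
    have h2 : (0 : ℝ) < n := by exact_mod_cast hn0
    have h3 : 0 ≤ Real.log n := Real.log_natCast_nonneg n
    have h4 := Real.log_le_log h2 h1
    change Real.log n ^ 2 ≤ _
    gcongr
  · rw [nsmul_eq_mul]
    exact mul_le_mul_of_nonneg_right (card_Ioc_floor_le hy hyz) (sq_nonneg _)

lemma sum_log_div_le {b : ℝ} (hb : 0 < b) :
    ∑ n ∈ Finset.Ioc 0 ⌊b⌋₊, (Real.log b - Real.log n) ≤ b := by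
  have h := Real.pow_div_factorial_le_exp b hb.le ⌊b⌋₊
  have hf : (0 : ℝ) < (⌊b⌋₊.factorial : ℝ) := by exact_mod_cast Nat.factorial_pos _
  have h' := Real.log_le_log (by positivity) h
  rw [Real.log_exp, Real.log_div (by positivity) hf.ne', Real.log_pow] at h'
  refine le_trans (le_of_eq ?_) h'
  rw [Finset.sum_sub_distrib, Finset.sum_const, Nat.card_Ioc, Nat.sub_zero, nsmul_eq_mul]
  congr 1
  rw [← Finset.prod_Ico_id_eq_factorial, Nat.cast_prod, Real.log_prod]
  · refine Finset.sum_congr ?_ fun _ _ => rfl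
    ext n
    simp only [Finset.mem_Ioc, Finset.mem_Ico]
    omega
  · intro n hn
    have := (Finset.mem_Ico.1 hn).1
    exact_mod_cast (by omega : n ≠ 0)

lemma le_summatory_log_sq_sub {a b : ℝ} (ha : 0 ≤ a) (hab : a ≤ b) (hb : 1 ≤ b) :
    (b - a - 1) * Real.log b ^ 2 - 2 * Real.log b * b ≤
      summatory (fun n => Real.log n ^ 2) b - summatory (fun n => Real.log n ^ 2) a := by
  rw [summatory_sub _ hab]
  have hL := Real.log_nonneg hb
  have key : ∀ n ∈ Finset.Ioc 0 ⌊b⌋₊, 0 ≤ Real.log n ∧ Real.log n ≤ Real.log b := by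
    intro n hn
    rw [Finset.mem_Ioc] at hn
    refine ⟨Real.log_natCast_nonneg n, Real.log_le_log (by exact_mod_cast hn.1) ?_⟩
    exact (Nat.le_floor_iff (by linarith)).1 hn.2
  have hsub : Finset.Ioc ⌊a⌋₊ ⌊b⌋₊ ⊆ Finset.Ioc 0 ⌊b⌋₊ :=
    Finset.Ioc_subset_Ioc_left (Nat.zero_le _)
  have h1 : ∑ n ∈ Finset.Ioc ⌊a⌋₊ ⌊b⌋₊, (Real.log b - Real.log n) ≤ b :=
    (Finset.sum_le_sum_of_subset_of_nonneg hsub fun n hn _ => by linarith [(key n hn).2]).trans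
      (sum_log_div_le (by linarith))
  have h2 : ∑ n ∈ Finset.Ioc ⌊a⌋₊ ⌊b⌋₊,
      (Real.log b ^ 2 - 2 * Real.log b * (Real.log b - Real.log n)) ≤
      ∑ n ∈ Finset.Ioc ⌊a⌋₊ ⌊b⌋₊, Real.log n ^ 2 := by
    refine Finset.sum_le_sum fun n hn => ?_
    nlinarith [sq_nonneg (Real.log b - Real.log n)]
  rw [Finset.sum_sub_distrib, Finset.sum_const, nsmul_eq_mul, ← Finset.mul_sum] at h2
  have h3 := mul_le_mul_of_nonneg_right (le_card_Ioc_floor ha hab) (sq_nonneg (Real.log b))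
  have h4 := mul_le_mul_of_nonneg_left h1 (by linarith : 0 ≤ 2 * Real.log b)
  linarith

lemma exists_abs_summatory_vonMangoldt_sub_le :
    ∃ C : ℝ, 0 < C ∧ ∀ x : ℝ, 1 ≤ x →
      |summatory (fun n => ArithmeticFunction.vonMangoldt n * Real.log n ^ 2) x -
        summatory (fun n => Real.log n ^ 2) x| ≤ C * (x * (1 + Real.log x)) := by
  obtain ⟨K, hK, h⟩ := exists_abs_sum_vonMangoldt_sub_one_mul_log_sq_le
  set u : ℕ → ℝ := fun n => ArithmeticFunction.vonMangoldt n * Real.log n ^ 2 with hu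
  set v : ℕ → ℝ := fun n => Real.log n ^ 2 with hv
  have hu0 : ∀ n, 0 ≤ u n := fun n =>
    mul_nonneg ArithmeticFunction.vonMangoldt_nonneg (sq_nonneg _)
  have hv0 : ∀ n, 0 ≤ v n := fun n => sq_nonneg _
  have hu1 : u 0 = 0 := by simp [hu]
  have hv1 : v 0 = 0 := by simp [hv]
  have hT : ∀ y : ℝ, 0 < y → ∀ N : ℕ, y ≤ N →
      |∑ n ∈ Finset.range N, u n * max 0 (y - n) -
        ∑ n ∈ Finset.range N, v n * max 0 (y - n)| ≤ K * y ^ 2 := by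
    intro y hy N hN
    refine le_trans (le_of_eq ?_) (h y hy N hN)
    rw [← Finset.sum_sub_distrib]
    congr 1
    refine Finset.sum_congr rfl fun n _ => ?_
    simp only [hu, hv]; ring
  refine ⟨10 * K + 3, by positivity, fun x hx => ?_⟩
  have hl := Real.log_nonneg hx
  have hlx := Real.log_le_sub_one_of_pos (by linarith : 0 < x)
  obtain ⟨L, hL⟩ : ∃ L, L = 1 + Real.log x := ⟨_, rfl⟩
  rw [← hL]
  have hL1 : 1 ≤ L := by linarith
  have hLx : L ≤ x := by linarith
  set d := x / (2 * L) with hd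
  have hd0 : 0 < d := by positivity
  have hdL : d * (2 * L) = x := by rw [hd]; field_simp
  have hdx : d ≤ x / 2 := by nlinarith
  obtain ⟨N, hN⟩ := exists_nat_gt (x + d)
  have tp := abs_le.1 (hT (x + d) (by linarith) N hN.le)
  have t0 := abs_le.1 (hT x (by linarith) N (by linarith))
  have tm := abs_le.1 (hT (x - d) (by linarith) N (by linarith))
  have p1 := mul_summatory_le hu0 hu1 (y := x) (z := x + d) (by linarith) (by linarith) hN
  have p2 := le_mul_summatory hu0 hu1 (y := x - d) (z := x) (N := N) (by linarith) (by linarith)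
    (by linarith)
  have q1 := le_mul_summatory hv0 hv1 (y := x) (z := x + d) (by linarith) (by linarith) hN
  have q2 := mul_summatory_le hv0 hv1 (y := x - d) (z := x) (N := N) (by linarith) (by linarith)
    (by linarith)
  have s1 := summatory_log_sq_sub_le (y := x) (z := x + d) (by linarith) (by linarith)
  have s2 := summatory_log_sq_sub_le (y := x - d) (z := x) (by linarith) (by linarith)
  have b1 : Real.log (x + d) ^ 2 ≤ L ^ 2 := by
    have := Real.log_le_log (by linarith) (by linarith : x + d ≤ 2 * x)
    rw [Real.log_mul (by norm_num) (by linarith)] at this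
    have h2 : Real.log 2 ≤ 1 := by linarith [Real.log_two_lt_d9]
    have h3 : 0 ≤ Real.log (x + d) := Real.log_nonneg (by linarith)
    exact pow_le_pow_left₀ h3 (by linarith) 2
  have b2 : Real.log x ^ 2 ≤ L ^ 2 := pow_le_pow_left₀ hl (by linarith) 2
  have e : (d + 1) * L ^ 2 ≤ 2 * (x * L) := by
    nlinarith [mul_nonneg (by linarith : 0 ≤ L) (by linarith : 0 ≤ x - L)]
  have s1' : summatory v (x + d) - summatory v x ≤ 2 * (x * L) := by
    refine s1.trans (le_trans ?_ e)
    rw [add_sub_cancel_left]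
    exact mul_le_mul_of_nonneg_left b1 (by linarith)
  have s2' : summatory v x - summatory v (x - d) ≤ 2 * (x * L) := by
    refine s2.trans (le_trans ?_ e)
    rw [sub_sub_cancel]
    exact mul_le_mul_of_nonneg_left b2 (by linarith)
  have kx : K * x ^ 2 = d * (2 * K * (x * L)) := by rw [← hdL]; ring
  have k1 : K * (x + d) ^ 2 ≤ 4 * (K * x ^ 2) := by
    have : (x + d) ^ 2 ≤ (2 * x) ^ 2 := pow_le_pow_left₀ (by linarith) (by linarith) 2
    nlinarith
  have k2 : K * (x - d) ^ 2 ≤ K * x ^ 2 := by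
    have : (x - d) ^ 2 ≤ x ^ 2 := pow_le_pow_left₀ (by linarith) (by linarith) 2
    nlinarith
  rw [add_sub_cancel_left] at p1 q1
  rw [sub_sub_cancel] at p2 q2
  have u1 : d * summatory u x ≤ d * (summatory v (x + d) + 10 * K * (x * L)) := by
    rw [mul_add]
    have : d * (10 * K * (x * L)) = 5 * (K * x ^ 2) := by rw [kx]; ring
    linarith
  have u2 : d * (summatory v (x - d) - 4 * K * (x * L)) ≤ d * summatory u x := by
    rw [mul_sub]
    have : d * (4 * K * (x * L)) = 2 * (K * x ^ 2) := by rw [kx]; ring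
    linarith
  have u1' := le_of_mul_le_mul_left u1 hd0
  have u2' := le_of_mul_le_mul_left u2 hd0
  have hxL : 0 < x * L := by positivity
  have hKx : 0 < K * (x * L) := by positivity
  rw [abs_le]
  constructor <;> linarith

lemma vonMangoldt_mul_log_sq_le {b : ℝ} {n : ℕ} (hn : 0 < n) (hb : (n : ℝ) ≤ b) :
    ArithmeticFunction.vonMangoldt n * Real.log n ^ 2 ≤
      (if n.Prime then Real.log b ^ 3 else 0) +
        (ArithmeticFunction.vonMangoldt n - if n.Prime then Real.log n else 0) *
          Real.log b ^ 2 := by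
  have h2 := Real.log_le_log (by exact_mod_cast hn) hb
  have h3 : 0 ≤ Real.log n := Real.log_natCast_nonneg n
  split_ifs with hp
  · rw [ArithmeticFunction.vonMangoldt_apply_prime hp, sub_self, zero_mul, add_zero,
      show Real.log n * Real.log n ^ 2 = Real.log n ^ 3 by ring]
    gcongr
  · rw [sub_zero, zero_add]
    have := ArithmeticFunction.vonMangoldt_nonneg (n := n)
    gcongr

lemma summatory_vonMangoldt_sub_le {a b : ℝ} (hab : a ≤ b) (hb : 1 ≤ b) :
    summatory (fun n => ArithmeticFunction.vonMangoldt n * Real.log n ^ 2) b -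
        summatory (fun n => ArithmeticFunction.vonMangoldt n * Real.log n ^ 2) a ≤
      ((Finset.Ioc ⌊a⌋₊ ⌊b⌋₊).filter Nat.Prime).card * Real.log b ^ 3 +
        2 * √b * Real.log b ^ 3 := by
  rw [summatory_sub _ hab]
  have h1 : ∑ n ∈ Finset.Ioc ⌊a⌋₊ ⌊b⌋₊, ArithmeticFunction.vonMangoldt n * Real.log n ^ 2 ≤
      ∑ n ∈ Finset.Ioc ⌊a⌋₊ ⌊b⌋₊, ((if n.Prime then Real.log b ^ 3 else 0) +
        (ArithmeticFunction.vonMangoldt n - if n.Prime then Real.log n else 0) *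
          Real.log b ^ 2) := by
    refine Finset.sum_le_sum fun n hn => ?_
    rw [Finset.mem_Ioc] at hn
    exact vonMangoldt_mul_log_sq_le (by omega) ((Nat.le_floor_iff (by linarith)).1 hn.2)
  rw [Finset.sum_add_distrib, ← Finset.sum_mul, ← Finset.sum_filter, Finset.sum_const,
    nsmul_eq_mul] at h1
  have h2 : ∑ n ∈ Finset.Ioc ⌊a⌋₊ ⌊b⌋₊,
      (ArithmeticFunction.vonMangoldt n - if n.Prime then Real.log n else 0) ≤
      Chebyshev.psi b - Chebyshev.theta b := by
    rw [Chebyshev.psi, Chebyshev.theta, Finset.sum_filter, ← Finset.sum_sub_distrib]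
    refine Finset.sum_le_sum_of_subset_of_nonneg
      (Finset.Ioc_subset_Ioc_left (Nat.zero_le _)) fun n _ _ => ?_
    split_ifs with hp
    · rw [ArithmeticFunction.vonMangoldt_apply_prime hp, sub_self]
    · rw [sub_zero]; exact ArithmeticFunction.vonMangoldt_nonneg
  have h3 := h2.trans (Chebyshev.psi_sub_theta_le hb)
  have h4 := mul_le_mul_of_nonneg_right h3 (sq_nonneg (Real.log b))
  calc _ ≤ _ := h1
    _ ≤ _ := add_le_add_right h4 _
    _ = _ := by ring

lemma log_sq_le_sqrt {b : ℝ} (hb : 1 ≤ b) : Real.log b ^ 2 ≤ 16 * √b := by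
  have h0 : 0 ≤ Real.log b := Real.log_nonneg hb
  have h1 : Real.log b ≤ 4 * √(√b) := by
    have := Real.log_le_self (Real.sqrt_nonneg (√b))
    rw [Real.log_sqrt (Real.sqrt_nonneg _), Real.log_sqrt (by linarith)] at this
    linarith
  calc Real.log b ^ 2 ≤ (4 * √(√b)) ^ 2 := pow_le_pow_left₀ h0 h1 2
    _ = 16 * √b := by rw [mul_pow, Real.sq_sqrt (Real.sqrt_nonneg _)]; norm_num

lemma exists_le_card_primes_Ioc :
    ∃ C : ℝ, 0 < C ∧ ∀ a b : ℝ, 1 ≤ a → a ≤ b → 3 ≤ b →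
      (b - a) / Real.log b - C * b / Real.log b ^ 2 ≤
        ((Finset.Ioc ⌊a⌋₊ ⌊b⌋₊).filter Nat.Prime).card := by
  obtain ⟨C, hC, h⟩ := exists_abs_summatory_vonMangoldt_sub_le
  refine ⟨4 * C + 35, by positivity, fun a b ha hab hb => ?_⟩
  have hL : 1 ≤ Real.log b := by
    rw [Real.le_log_iff_exp_le (by linarith)]
    linarith [Real.exp_one_lt_d9]
  have h1 := abs_le.1 (h b (by linarith))
  have h2 := abs_le.1 (h a ha)
  have h3 := le_summatory_log_sq_sub (by linarith : 0 ≤ a) hab (by linarith)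
  have h4 := summatory_vonMangoldt_sub_le hab (by linarith)
  have h5 := log_sq_le_sqrt (by linarith : 1 ≤ b)
  have h6 : Real.log a ≤ Real.log b := Real.log_le_log (by linarith) hab
  have hlb := Real.log_le_self (by linarith : 0 ≤ b)
  have h7 : a * (1 + Real.log a) ≤ 2 * (b * Real.log b) := by
    have := Real.log_nonneg ha
    have : a * (1 + Real.log a) ≤ b * (1 + Real.log b) := by gcongr
    nlinarith
  have h8 : b * (1 + Real.log b) ≤ 2 * (b * Real.log b) := by nlinarith
  set M : ℝ := (((Finset.Ioc ⌊a⌋₊ ⌊b⌋₊).filter Nat.Prime).card : ℝ)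
  set l := Real.log b
  have h9 : √b * l ^ 3 ≤ 16 * (b * l) := by
    have := mul_le_mul_of_nonneg_left h5 (by positivity : 0 ≤ √b * l)
    have e : √b * l * (16 * √b) = 16 * ((√b * √b) * l) := by ring
    rw [e, Real.mul_self_sqrt (by linarith)] at this
    linarith [show √b * l ^ 3 = √b * l * l ^ 2 by ring]
  have h10 : l ^ 2 ≤ b * l := by nlinarith
  have h11 : (b - a) * l ^ 2 - (4 * C + 35) * (b * l) ≤ M * l ^ 3 := by
    have := mul_le_mul_of_nonneg_left h7 hC.le
    have := mul_le_mul_of_nonneg_left h8 hC.le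
    nlinarith
  have hl0 : 0 < l := by linarith
  have e : (b - a) / l - (4 * C + 35) * b / l ^ 2 =
      ((b - a) * l ^ 2 - (4 * C + 35) * (b * l)) / l ^ 3 := by
    field_simp
  rw [e, div_le_iff₀ (by positivity)]
  exact h11

lemma piStar_eq_sum_indicator (α β : ℝ) {x : ℝ} (hx : 0 ≤ x) :
    (piStar α β x : ℝ) = ∑ p ∈ (Finset.Ioc 0 ⌊x⌋₊).filter Nat.Prime,
      {a : ℝ | Nat.Prime (⌊a * p + β⌋).toNat}.indicator 1 α := by
  have : {p : ℕ | p.Prime ∧ (p : ℝ) ≤ x ∧ Nat.Prime (⌊α * p + β⌋).toNat} =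
      (((Finset.Ioc 0 ⌊x⌋₊).filter Nat.Prime).filter
        fun p : ℕ => Nat.Prime (⌊α * p + β⌋).toNat : Finset ℕ) := by
    ext p
    simp only [Set.mem_ofPred_eq, Finset.coe_filter, Finset.mem_filter, Finset.mem_Ioc,
      Nat.le_floor_iff hx]
    exact ⟨fun h => ⟨⟨⟨h.1.pos, h.2.1⟩, h.1⟩, h.2.2⟩, fun h => ⟨h.1.2, h.1.1.2, h.2⟩⟩
  rw [piStar, this, Set.ncard_coe_finset, Finset.card_filter, Nat.cast_sum]
  refine Finset.sum_congr rfl fun p _ => ?_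
  simp [Set.indicator_apply]

lemma measurableSet_prime_floor (β : ℝ) (p : ℕ) :
    MeasurableSet {a : ℝ | Nat.Prime (⌊a * p + β⌋).toNat} := by
  have h : Measurable fun a : ℝ => ⌊a * p + β⌋ := by
    exact Int.measurable_floor.comp (by fun_prop)
  exact h (MeasurableSet.of_discrete (s := {z : ℤ | Nat.Prime z.toNat}))

lemma card_div_le_integral_indicator {c₁ c₂ β : ℝ} {p : ℕ} (hp : 0 < p)
    (ha : 0 ≤ c₁ * p + β) (hb : 0 ≤ c₂ * p + β - 1) :
    (((Finset.Ioc ⌊c₁ * p + β⌋₊ ⌊c₂ * p + β - 1⌋₊).filter Nat.Prime).card : ℝ) / p ≤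
      ∫ α in Set.Ioo c₁ c₂, {a : ℝ | Nat.Prime (⌊a * p + β⌋).toNat}.indicator (1 : ℝ → ℝ) α := by
  have hp0 : (0 : ℝ) < p := by exact_mod_cast hp
  set s := (Finset.Ioc ⌊c₁ * p + β⌋₊ ⌊c₂ * p + β - 1⌋₊).filter Nat.Prime with hs
  set I : ℕ → Set ℝ := fun q => Set.Ico ((q - β) / p) ((q + 1 - β) / p) with hI
  have hfl : ∀ q : ℕ, ∀ α ∈ I q, ⌊α * p + β⌋ = (q : ℤ) := by
    intro q α hα
    have h1 := (div_le_iff₀ hp0).1 hα.1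
    have h2 := (lt_div_iff₀ hp0).1 hα.2
    rw [Int.floor_eq_iff]
    constructor <;> push_cast <;> linarith
  have hsub : (⋃ q ∈ s, I q) ⊆ {a : ℝ | Nat.Prime (⌊a * p + β⌋).toNat} ∩ Set.Ioo c₁ c₂ := by
    intro α hα
    simp only [Set.mem_iUnion] at hα
    obtain ⟨q, hq, hα⟩ := hα
    rw [hs, Finset.mem_filter, Finset.mem_Ioc, Nat.floor_lt ha, Nat.le_floor_iff hb] at hq
    refine ⟨?_, ?_, ?_⟩
    · change Nat.Prime _
      rw [hfl q α hα, Int.toNat_natCast]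
      exact hq.2
    · refine lt_of_lt_of_le ?_ hα.1
      rw [lt_div_iff₀ hp0]; linarith [hq.1.1]
    · refine lt_of_lt_of_le hα.2 ?_
      rw [div_le_iff₀ hp0]; linarith [hq.1.2]
  rw [integral_indicator_one (measurableSet_prime_floor β p),
    measureReal_restrict_apply (measurableSet_prime_floor β p)]
  have hfin : volume ({a : ℝ | Nat.Prime (⌊a * p + β⌋).toNat} ∩ Set.Ioo c₁ c₂) ≠ ⊤ :=
    measure_ne_top_of_subset Set.inter_subset_right (by simp)
  refine le_trans (le_of_eq ?_) (measureReal_mono hsub hfin)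
  rw [measureReal_biUnion_finset (h := fun q _ => measure_Ico_lt_top.ne)]
  · have : ∀ q ∈ s, volume.real (I q) = 1 / p := by
      intro q _
      rw [Real.volume_real_Ico_of_le (by gcongr; linarith)]
      ring
    rw [Finset.sum_congr rfl this, Finset.sum_const, nsmul_eq_mul, mul_one_div]
  · intro q _ r _ hqr
    refine Set.disjoint_left.2 fun α h1 h2 => hqr ?_
    exact_mod_cast (hfl q α h1).symm.trans (hfl r α h2)
  · exact fun q _ => measurableSet_Ico

lemma integral_piStar_eq_sum (c₁ c₂ β : ℝ) {x : ℝ} (hx : 0 ≤ x) :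
    ∫ α in Set.Ioo c₁ c₂, (piStar α β x : ℝ) =
      ∑ p ∈ (Finset.Ioc 0 ⌊x⌋₊).filter Nat.Prime, ∫ α in Set.Ioo c₁ c₂,
        {a : ℝ | Nat.Prime (⌊a * p + β⌋).toNat}.indicator (1 : ℝ → ℝ) α := by
  simp_rw [piStar_eq_sum_indicator _ β hx]
  refine integral_finsetSum _ fun p _ => ?_
  exact (integrable_const (1 : ℝ)).indicator (measurableSet_prime_floor β p)

lemma exists_le_card_primes_Ioc_div {c₁ c₂ : ℝ} (β : ℝ) (hc₁ : 0 < c₁) (hc : c₁ < c₂) :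
    ∃ C : ℝ, 0 < C ∧ ∃ x₀ : ℝ, ∀ x : ℝ, x₀ ≤ x → ∀ p : ℕ, √x < p → (p : ℝ) ≤ x →
      0 ≤ c₁ * p + β ∧ 0 ≤ c₂ * p + β - 1 ∧
      (c₂ - c₁) / Real.log x - C / Real.log x ^ 2 ≤
        (((Finset.Ioc ⌊c₁ * p + β⌋₊ ⌊c₂ * p + β - 1⌋₊).filter Nat.Prime).card : ℝ) / p := by
  obtain ⟨C, hC, h⟩ := exists_le_card_primes_Ioc
  have hc₂ : 0 < c₂ := hc₁.trans hc
  have hD : 0 < c₂ - c₁ := sub_pos.2 hc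
  set k := Real.log (c₂ + 1) with hk
  have hk0 : 0 < k := Real.log_pos (by linarith)
  set P := |β| + (2 / c₂) ^ 2 + 2 * (|β| + 1) / c₂ + (1 + |β|) / c₁ + 1 / (c₂ - c₁) + 6 / c₂
    with hP
  refine ⟨(c₂ - c₁) * k + 4 + 16 * C * (c₂ + 1), by positivity, P ^ 2 + 9, ?_⟩
  intro x hx p hp hpx
  have hP0 : 0 ≤ P := by positivity
  have hPp : P ≤ p := le_trans (Real.le_sqrt_of_sq_le (by linarith)) hp.le
  have t1 : |β| ≤ P := by
    have : 0 ≤ (2 / c₂) ^ 2 + 2 * (|β| + 1) / c₂ + (1 + |β|) / c₁ + 1 / (c₂ - c₁) + 6 / c₂ := by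
      positivity
    linarith
  have t2 : (2 / c₂) ^ 2 ≤ P := by
    have : 0 ≤ |β| + 2 * (|β| + 1) / c₂ + (1 + |β|) / c₁ + 1 / (c₂ - c₁) + 6 / c₂ := by
      positivity
    linarith
  have t3 : 2 * (|β| + 1) / c₂ ≤ P := by
    have : 0 ≤ |β| + (2 / c₂) ^ 2 + (1 + |β|) / c₁ + 1 / (c₂ - c₁) + 6 / c₂ := by positivity
    linarith
  have t4 : (1 + |β|) / c₁ ≤ P := by
    have : 0 ≤ |β| + (2 / c₂) ^ 2 + 2 * (|β| + 1) / c₂ + 1 / (c₂ - c₁) + 6 / c₂ := by positivity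
    linarith
  have t5 : 1 / (c₂ - c₁) ≤ P := by
    have : 0 ≤ |β| + (2 / c₂) ^ 2 + 2 * (|β| + 1) / c₂ + (1 + |β|) / c₁ + 6 / c₂ := by positivity
    linarith
  have t6 : 6 / c₂ ≤ P := by
    have : 0 ≤ |β| + (2 / c₂) ^ 2 + 2 * (|β| + 1) / c₂ + (1 + |β|) / c₁ + 1 / (c₂ - c₁) := by
      positivity
    linarith
  have hβ := abs_le.1 (le_refl |β|)
  have r3 := (div_le_iff₀ hc₂).1 (t3.trans hPp)
  have r4 := (div_le_iff₀ hc₁).1 (t4.trans hPp)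
  have r5 := (div_le_iff₀ hD).1 (t5.trans hPp)
  have r6 := (div_le_iff₀ hc₂).1 (t6.trans hPp)
  have hx9 : 9 ≤ x := by nlinarith
  have hsx : 3 ≤ √x := Real.le_sqrt_of_sq_le (by linarith)
  have hp3 : (3 : ℝ) < p := by linarith
  have hp0 : (0 : ℝ) < p := by linarith
  set a := c₁ * p + β with ha
  set b := c₂ * p + β - 1 with hb
  have ha1 : 1 ≤ a := by linarith
  have hab : a ≤ b := by linarith
  have hbp : c₂ / 2 * p ≤ b := by linarith
  have hb3 : 3 ≤ b := by linarith
  have hbu : b ≤ (c₂ + 1) * p := by linarith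
  have hl1 : 1 ≤ Real.log x := by
    rw [Real.le_log_iff_exp_le (by linarith)]
    linarith [Real.exp_one_lt_d9]
  have hlb1 : Real.log b ≤ Real.log x + k := by
    have h1 := Real.log_le_log (by linarith) hbu
    rw [Real.log_mul (by linarith) hp0.ne'] at h1
    have h2 := Real.log_le_log hp0 hpx
    linarith
  have hlb2 : Real.log x ≤ 4 * Real.log b := by
    have h1 : √(p : ℝ) ≤ b := by
      refine le_trans ?_ hbp
      have h2 : 2 / c₂ ≤ √(p : ℝ) := Real.le_sqrt_of_sq_le (t2.trans hPp)
      have h3 : 1 ≤ c₂ / 2 * √(p : ℝ) := by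
        have := (div_le_iff₀ hc₂).1 h2
        linarith
      calc √(p : ℝ) = 1 * √(p : ℝ) := (one_mul _).symm
        _ ≤ c₂ / 2 * √(p : ℝ) * √(p : ℝ) := by gcongr
        _ = c₂ / 2 * p := by rw [mul_assoc, Real.mul_self_sqrt hp0.le]
    have h4 := Real.log_le_log (Real.sqrt_pos.2 hp0) h1
    have h5 := Real.log_le_log (by linarith) hp.le
    rw [Real.log_sqrt hp0.le] at h4
    rw [Real.log_sqrt (by linarith)] at h5
    linarith
  have hlx : Real.log x ≤ 4 * √x := by
    have h1 := Real.log_le_self (Real.sqrt_nonneg x)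
    rw [Real.log_sqrt (by linarith)] at h1
    linarith
  refine ⟨by linarith, by linarith, ?_⟩
  have hmain := h a b ha1 hab hb3
  rw [le_div_iff₀ hp0]
  refine le_trans ?_ hmain
  set l := Real.log x
  set m := Real.log b
  have hl0 : 0 < l := by linarith
  have hm0 : 0 < m := by linarith
  have e1 : C * b / m ^ 2 ≤ 16 * C * (c₂ + 1) * p / l ^ 2 := by
    rw [div_le_div_iff₀ (by positivity) (by positivity)]
    have h1 : l ^ 2 ≤ (4 * m) ^ 2 := pow_le_pow_left₀ hl0.le hlb2 2
    calc C * b * l ^ 2 ≤ C * ((c₂ + 1) * p) * (4 * m) ^ 2 := by gcongr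
      _ = _ := by ring
  have e2 : (b - a) / (l + k) ≤ (b - a) / m :=
    div_le_div_of_nonneg_left (by linarith) hm0 hlb1
  have e3 : ((c₂ - c₁) / l - ((c₂ - c₁) * k + 4) / l ^ 2) * p ≤ (b - a) / (l + k) := by
    rw [le_div_iff₀ (by positivity)]
    have e4 : ((c₂ - c₁) / l - ((c₂ - c₁) * k + 4) / l ^ 2) * p * (l + k) =
        (c₂ - c₁) * p - 4 * p / l - (((c₂ - c₁) * k + 4) * k * p) / l ^ 2 := by
      field_simp
      ring
    have e5 : 1 ≤ 4 * p / l := by rw [le_div_iff₀ hl0]; linarith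
    have e6 : 0 ≤ (((c₂ - c₁) * k + 4) * k * p) / l ^ 2 := by positivity
    have e7 : b - a = (c₂ - c₁) * p - 1 := by rw [ha, hb]; ring
    rw [e4, e7]; linarith
  have e8 : ((c₂ - c₁) / l - ((c₂ - c₁) * k + 4 + 16 * C * (c₂ + 1)) / l ^ 2) * p =
      ((c₂ - c₁) / l - ((c₂ - c₁) * k + 4) / l ^ 2) * p - 16 * C * (c₂ + 1) * p / l ^ 2 := by
    ring
  rw [e8]
  linarith

theorem integral_piStar_lower_bound
    (c₁ c₂ β : ℝ) (hc₁ : 0 < c₁) (hc : c₁ < c₂) :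
    ∃ C : ℝ, 0 < C ∧ ∃ x₀ : ℝ, ∀ x : ℝ, x₀ ≤ x →
      (c₂ - c₁) * (x / (Real.log x) ^ 2) * (1 - C / Real.log x) ≤
        ∫ α in Set.Ioo c₁ c₂, (piStar α β x : ℝ) := by
  obtain ⟨C₁, hC₁, x₁, h₁⟩ := exists_le_card_primes_Ioc_div β hc₁ hc
  obtain ⟨C₂, hC₂, h₂⟩ := exists_le_card_primes_Ioc
  have hD : 0 < c₂ - c₁ := sub_pos.2 hc
  refine ⟨C₁ / (c₂ - c₁) + (C₂ + 4), by positivity,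
    max (max x₁ 9) (Real.exp (C₁ / (c₂ - c₁))), fun x hx => ?_⟩
  have hx1 : x₁ ≤ x := (le_max_left _ _).trans ((le_max_left _ _).trans hx)
  have hx9 : 9 ≤ x := (le_max_right _ _).trans ((le_max_left _ _).trans hx)
  have hlC : C₁ / (c₂ - c₁) ≤ Real.log x := by
    rw [Real.le_log_iff_exp_le (by linarith)]
    exact (le_max_right _ _).trans hx
  have hx0 : 0 < x := by linarith
  have hsx : 3 ≤ √x := Real.le_sqrt_of_sq_le (by linarith)
  have hsq : √x * √x = x := Real.mul_self_sqrt hx0.le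
  have hsxx : √x ≤ x := by nlinarith
  have hl1 : 1 ≤ Real.log x := by
    rw [Real.le_log_iff_exp_le hx0]
    linarith [Real.exp_one_lt_d9]
  have hlx : Real.log x ≤ 4 * √x := by
    have h1 := Real.log_le_self (Real.sqrt_nonneg x)
    rw [Real.log_sqrt hx0.le] at h1
    linarith
  have hcard := h₂ (√x) x (by linarith) hsxx (by linarith)
  rw [integral_piStar_eq_sum c₁ c₂ β hx0.le]
  set l := Real.log x
  have hl0 : 0 < l := by linarith
  set m := (c₂ - c₁) / l - C₁ / l ^ 2 with hm
  have hm0 : 0 ≤ m := by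
    have : m = (c₂ - c₁) * (l - C₁ / (c₂ - c₁)) / l ^ 2 := by rw [hm]; field_simp
    rw [this]
    have := sub_nonneg.2 hlC
    positivity
  have hsum : (((Finset.Ioc ⌊√x⌋₊ ⌊x⌋₊).filter Nat.Prime).card : ℝ) * m ≤
      ∑ p ∈ (Finset.Ioc 0 ⌊x⌋₊).filter Nat.Prime, ∫ α in Set.Ioo c₁ c₂,
        {a : ℝ | Nat.Prime (⌊a * p + β⌋).toNat}.indicator (1 : ℝ → ℝ) α := by
    rw [← nsmul_eq_mul]
    refine (Finset.card_nsmul_le_sum _ _ m fun p hp => ?_).trans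
      (Finset.sum_le_sum_of_subset_of_nonneg (Finset.filter_subset_filter _
        (Finset.Ioc_subset_Ioc_left (Nat.zero_le _))) fun p _ _ => ?_)
    · rw [Finset.mem_filter, Finset.mem_Ioc, Nat.floor_lt (Real.sqrt_nonneg x),
        Nat.le_floor_iff hx0.le] at hp
      obtain ⟨ha, hb, h⟩ := h₁ x hx1 p hp.1.1 hp.1.2
      exact h.trans (card_div_le_integral_indicator hp.2.pos ha hb)
    · exact integral_nonneg fun α => Set.indicator_nonneg (fun _ _ => zero_le_one) α
  refine le_trans ?_ hsum
  have hM : x / l - (C₂ + 4) * x / l ^ 2 ≤ (x - √x) / l - C₂ * x / l ^ 2 := by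
    have h1 : √x / l ≤ 4 * x / l ^ 2 := by
      rw [div_le_div_iff₀ hl0 (by positivity)]
      have : √x * l ≤ √x * (4 * √x) := by gcongr
      nlinarith
    have h2 : (C₂ + 4) * x / l ^ 2 = C₂ * x / l ^ 2 + 4 * x / l ^ 2 := by ring
    rw [h2, sub_div]; linarith
  refine le_trans ?_ (mul_le_mul_of_nonneg_right (hM.trans hcard) hm0)
  have e : (x / l - (C₂ + 4) * x / l ^ 2) * m =
      (c₂ - c₁) * (x / l ^ 2) * (1 - (C₁ / (c₂ - c₁) + (C₂ + 4)) / l) +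
        (C₂ + 4) * C₁ * x / l ^ 4 := by
    rw [hm]; field_simp; ring
  rw [e]
  have : 0 ≤ (C₂ + 4) * C₁ * x / l ^ 4 := by positivity
  linarith
end
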